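/- arXiv:2509.11505 — 4 statements merged into one kernel-verified Lean document; each statement's English description precedes it below -/
import Mathlib

section
/- Fix q = 2 (the Ising model) and a real t > 1. Then 𝓑(t,2) ∩ (0,∞) = ∅ if 1 < t < 3, and 𝓑(t,2) ∩ (0,∞) = {1, z_c^−(t,2), z_c^+(t,2)} if t ≥ 3, where z_c^±(t,2) = (t⁴ − 6t² − 3 ± √((t²−1)³(t²−9)))/(8t). -/
noncomputable section

/-- The pair `(Z_n^0(z), Z_n^1(z))` of conditional partition functions of the
`q`-state Potts model on the depth-`n` rooted binary Cayley tree, in the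
field-like variable `z` and temperature-like variable `t`. -/
def ZZpair (q : ℕ) (t : ℝ) : ℕ → ℂ → ℂ × ℂ
  | 0, z => (z⁻¹, 1)
  | n + 1, z =>
      (z⁻¹ * ((ZZpair q t n z).1 + ((q : ℂ) - 1) * (t : ℂ) * (ZZpair q t n z).2) ^ 2,
       ((t : ℂ) * (ZZpair q t n z).1 + (1 + ((q : ℂ) - 2) * (t : ℂ)) * (ZZpair q t n z).2) ^ 2)

/-- The full partition function `Z_n(z) = Z_n^0(z) + (q-1)·Z_n^1(z)` of the
rooted binary Cayley tree of depth `n`. -/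
def Zrooted (q : ℕ) (t : ℝ) (n : ℕ) (z : ℂ) : ℂ :=
  (ZZpair q t n z).1 + ((q : ℂ) - 1) * (ZZpair q t n z).2

/-- The accumulation set `𝓑(t,q)` of the Lee–Yang zeros of the rooted binary
Cayley tree: the closure of the set of zeros of some `Z_n` in `ℂ ∖ {0}`. -/
def BLY (t : ℝ) (q : ℕ) : Set ℂ :=
  closure {z : ℂ | z ≠ 0 ∧ ∃ n : ℕ, Zrooted q t n z = 0}

/-- The positive real axis `(0,∞)` viewed as a subset of `ℂ`. -/
def posAxis : Set ℂ := {z : ℂ | ∃ x : ℝ, 0 < x ∧ z = (x : ℂ)}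

/-- `z_c^+(t,2)` for the Ising model. -/
def zcPlus2 (t : ℝ) : ℝ :=
  (t ^ 4 - 6 * t ^ 2 - 3 + Real.sqrt ((t ^ 2 - 1) ^ 3 * (t ^ 2 - 9))) / (8 * t)

/-- `z_c^−(t,2)` for the Ising model. -/
def zcMinus2 (t : ℝ) : ℝ :=
  (t ^ 4 - 6 * t ^ 2 - 3 - Real.sqrt ((t ^ 2 - 1) ^ 3 * (t ^ 2 - 9))) / (8 * t)

/-- **Bloch's theorem**, with a non-optimal constant. -/
theorem exists_ball_subset_image_ball {f : ℂ → ℂ} {c : ℂ} {R : ℝ} (hR : 0 < R)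
    (hf : DifferentiableOn ℂ f (Metric.ball c R)) :
    ∃ w, Metric.ball w (R * ‖deriv f c‖ / 96) ⊆ f '' Metric.ball c R := by
  rcases eq_or_ne (deriv f c) 0 with h0 | h0
  · exact ⟨0, by simp [h0]⟩
  have hdf : DifferentiableOn ℂ (deriv f) (Metric.ball c R) := hf.deriv Metric.isOpen_ball
  have hsub : Metric.closedBall c (R / 2) ⊆ Metric.ball c R :=
    Metric.closedBall_subset_ball (by linarith)
  obtain ⟨a, ha, hmax⟩ := (isCompact_closedBall c (R / 2)).exists_isMaxOn
    (f := fun z => (R / 2 - ‖z - c‖) * ‖deriv f z‖) ⟨c, by simp; linarith⟩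
    ((by fun_prop : Continuous fun z : ℂ => R / 2 - ‖z - c‖).continuousOn.mul
      (hdf.continuousOn.mono hsub).norm)
  have hM : R / 2 * ‖deriv f c‖ ≤ (R / 2 - ‖a - c‖) * ‖deriv f a‖ := by
    simpa using hmax (Metric.mem_closedBall_self (by linarith : 0 ≤ R / 2))
  have hc0 : 0 < ‖deriv f c‖ := norm_pos_iff.2 h0
  have ha' : ‖a - c‖ ≤ R / 2 := by simpa [dist_eq_norm] using ha
  have hmul : 0 < (R / 2 - ‖a - c‖) * ‖deriv f a‖ := lt_of_lt_of_le (by positivity) hM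
  have hs : 0 < R / 2 - ‖a - c‖ := by
    rcases eq_or_lt_of_le ha' with h | h
    · simp [h] at hmul
    · linarith
  have hm : 0 < ‖deriv f a‖ := (pos_iff_pos_of_mul_pos hmul).1 hs
  set m := ‖deriv f a‖ with hm_def
  set s := (R / 2 - ‖a - c‖) / 2 with hs_def
  have hs0 : 0 < s := by positivity
  have hball : ∀ z ∈ Metric.ball a s, z ∈ Metric.closedBall c (R / 2) ∧ ‖deriv f z‖ ≤ 2 * m := by
    intro z hz
    have hz1 : ‖z - a‖ < s := by simpa [dist_eq_norm] using hz
    have hz2 : ‖z - c‖ ≤ ‖z - a‖ + ‖a - c‖ := by simpa using norm_add_le (z - a) (a - c)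
    have hzc : z ∈ Metric.closedBall c (R / 2) := by
      simp only [Metric.mem_closedBall, dist_eq_norm]; linarith
    refine ⟨hzc, ?_⟩
    have h1 : (R / 2 - ‖z - c‖) * ‖deriv f z‖ ≤ (R / 2 - ‖a - c‖) * m := hmax hzc
    have h2 : s * ‖deriv f z‖ ≤ (R / 2 - ‖z - c‖) * ‖deriv f z‖ := by
      gcongr; linarith
    have h3 : s * ‖deriv f z‖ ≤ s * (2 * m) := by
      calc _ ≤ _ := h2.trans h1
        _ = _ := by rw [hs_def]; ring
    exact le_of_mul_le_mul_left h3 hs0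
  have hsubs : Metric.ball a s ⊆ Metric.ball c R := fun z hz => hsub (hball z hz).1
  have hlip : ∀ z ∈ Metric.ball a s, ‖deriv f z - deriv f a‖ ≤ 3 * m / s * ‖z - a‖ := by
    intro z hz
    have := Complex.dist_le_div_mul_dist_of_mapsTo_ball (R₂ := 3 * m) (hdf.mono hsubs) (by
      intro w hw
      have := norm_sub_le (deriv f w) (deriv f a)
      have := (hball w hw).2
      simp only [Metric.mem_closedBall, dist_eq_norm]; linarith) hz
    simpa [dist_eq_norm] using this
  have hcl : Metric.closedBall a (s / 6) ⊆ Metric.ball a s :=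
    Metric.closedBall_subset_ball (by linarith)
  have hdiff : ∀ z ∈ Metric.ball c R, DifferentiableAt ℂ f z := fun z hz =>
    (hf z hz).differentiableAt (Metric.isOpen_ball.mem_nhds hz)
  have hgrow : ∀ z ∈ Metric.sphere a (s / 6), m * s / 12 ≤ ‖f z - f a‖ := by
    intro z hz
    have hz' : z ∈ Metric.closedBall a (s / 6) := Metric.sphere_subset_closedBall hz
    have haa : a ∈ Metric.closedBall a (s / 6) := Metric.mem_closedBall_self (by linarith)
    have hza : ‖z - a‖ = s / 6 := by simpa [dist_eq_norm] using hz
    have key := (convex_closedBall a (s / 6)).norm_image_sub_le_of_norm_hasDerivWithin_le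
      (f := fun z => f z - deriv f a * z) (f' := fun z => deriv f z - deriv f a) (C := m / 2)
      (fun w hw => (((hdiff w (hsubs (hcl hw))).hasDerivAt.sub
        ((hasDerivAt_id w).const_mul (deriv f a))).congr_deriv (by simp)).hasDerivWithinAt)
      (fun w hw => (hlip w (hcl hw)).trans (by
        have hw' : ‖w - a‖ ≤ s / 6 := by simpa [dist_eq_norm] using hw
        calc 3 * m / s * ‖w - a‖ ≤ 3 * m / s * (s / 6) := by gcongr
          _ = m / 2 := by field_simp; ring)) haa hz'
    have h1 : ‖deriv f a * (z - a)‖ = m * (s / 6) := by rw [norm_mul, hza]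
    have h2 : deriv f a * (z - a) = (f z - f a) - ((f z - deriv f a * z) - (f a - deriv f a * a)) := by
      ring
    have h3 := norm_sub_le (f z - f a) ((f z - deriv f a * z) - (f a - deriv f a * a))
    rw [← h2, h1] at h3
    rw [hza] at key
    linarith
  have himg := ((hf.mono hsubs).diffContOnCl_ball hcl).ball_subset_image_closedBall (by positivity) hgrow
    (by
      have h := (hdiff a (hsub ha)).hasDerivAt.eventually_ne (c := f a) (norm_pos_iff.1 hm)
      exact (h.frequently).filter_mono nhdsWithin_le_nhds)
  refine ⟨f a, (Metric.ball_subset_ball ?_).trans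
    (himg.trans (Set.image_mono (hcl.trans hsubs)))⟩
  rw [hs_def]
  linarith

/-- A zero-free holomorphic function on a disc has a holomorphic logarithm with a prescribed value
at the centre. -/
theorem exists_log_on_ball {f : ℂ → ℂ} {c : ℂ} {R : ℝ} (hR : 0 < R)
    (hf : DifferentiableOn ℂ f (Metric.ball c R)) (h0 : ∀ z ∈ Metric.ball c R, f z ≠ 0) (v : ℂ)
    (hv : Complex.exp v = f c) :
    ∃ g : ℂ → ℂ, DifferentiableOn ℂ g (Metric.ball c R) ∧ g c = v ∧
      ∀ z ∈ Metric.ball c R, Complex.exp (g z) = f z := by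
  have hd : DifferentiableOn ℂ (fun z => deriv f z / f z) (Metric.ball c R) :=
    (hf.deriv Metric.isOpen_ball).div hf h0
  obtain ⟨g, hgc, hg⟩ := hd.isExactOn_ball.with_val_at c v
  refine ⟨g, fun z hz => (hg z hz).differentiableAt.differentiableWithinAt, hgc, ?_⟩
  have hcm : c ∈ Metric.ball c R := Metric.mem_ball_self hR
  have hq : ∀ z ∈ Metric.ball c R,
      HasDerivAt (fun z => Complex.exp (-g z) * f z) 0 z := by
    intro z hz
    have h1 := (hf z hz).differentiableAt (Metric.isOpen_ball.mem_nhds hz) |>.hasDerivAt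
    refine ((hg z hz).neg.cexp.mul h1).congr_deriv ?_
    have := h0 z hz
    field_simp
    ring
  intro z hz
  have hconst := (convex_ball c R).norm_image_sub_le_of_norm_hasDerivWithin_le (C := 0)
    (fun w hw => (hq w hw).hasDerivWithinAt) (by simp) hcm hz
  have h2 : Complex.exp (-g z) * f z = 1 := by
    have : Complex.exp (-g z) * f z - Complex.exp (-g c) * f c = 0 := by simpa using hconst
    rw [sub_eq_zero] at this
    rw [this, hgc, ← hv, ← Complex.exp_add]; simp
  calc Complex.exp (g z) = Complex.exp (g z) * (Complex.exp (-g z) * f z) := by rw [h2, mul_one]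
    _ = f z := by rw [← mul_assoc, ← Complex.exp_add]; simp

theorem exists_cosh_sq_eq_int (x : ℝ) : ∃ y : ℝ, |y - x| ≤ 1 ∧ ∃ n : ℤ, Real.cosh y ^ 2 = n := by
  have main : ∀ x : ℝ, 0 ≤ x → ∃ y : ℝ, |y - x| ≤ 1 ∧ ∃ n : ℤ, Real.cosh y ^ 2 = n := by
    intro x hx
    have h1 : Real.cosh x ^ 2 + 1 ≤ Real.cosh (x + 1) ^ 2 := by
      rw [Real.cosh_add]
      have hc := Real.one_le_cosh x
      have hs := Real.sinh_nonneg_iff.2 hx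
      have hs1 := Real.sinh_nonneg_iff.2 (zero_le_one (α := ℝ))
      have hc1 : 3 / 2 ≤ Real.cosh 1 := by
        rw [Real.cosh_eq]
        have := Real.quadratic_le_exp_of_nonneg (zero_le_one (α := ℝ))
        have h2 := Real.add_one_le_exp (1 : ℝ)
        have h3 := Real.exp_pos (-1 : ℝ)
        have h4 := Real.exp_one_gt_d9
        have h5 : 1 / 3 < Real.exp (-1) := by
          rw [Real.exp_neg, ← one_div]
          exact one_div_lt_one_div_of_lt (Real.exp_pos 1) (by linarith [Real.exp_one_lt_d9])
        linarith
      have : 3 / 2 * Real.cosh x ≤ Real.cosh x * Real.cosh 1 + Real.sinh x * Real.sinh 1 := by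
        nlinarith [mul_nonneg hs hs1]
      nlinarith
    obtain ⟨y, hy, hyn⟩ := intermediate_value_Icc (by linarith : x ≤ x + 1)
      (f := fun y => Real.cosh y ^ 2) (by fun_prop)
      (show ((⌈Real.cosh x ^ 2⌉ : ℤ) : ℝ) ∈ _ from
        ⟨Int.le_ceil _, (Int.ceil_lt_add_one _).le.trans h1⟩)
    exact ⟨y, abs_le.2 ⟨by linarith [hy.1], by linarith [hy.2]⟩, _, hyn⟩
  rcases le_total 0 x with hx | hx
  · exact main x hx
  · obtain ⟨y, hy, n, hn⟩ := main (-x) (by linarith)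
    refine ⟨-y, ?_, n, by simpa using hn⟩
    rw [← abs_neg]; convert hy using 2; ring

theorem exists_ccosh_sq_eq_int (w : ℂ) : ∃ v : ℂ, ‖v - w‖ < 4 ∧ ∃ n : ℤ, Complex.cosh v ^ 2 = n := by
  obtain ⟨y, hy, n, hn⟩ := exists_cosh_sq_eq_int w.re
  have hpi := Real.pi_pos
  refine ⟨y + (round (w.im / Real.pi) * Real.pi : ℝ) * Complex.I, ?_, n, ?_⟩
  · refine (Complex.norm_le_abs_re_add_abs_im _).trans_lt ?_
    have h := abs_sub_round (w.im / Real.pi)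
    have h2 : |round (w.im / Real.pi) * Real.pi - w.im| ≤ 1 / 2 * Real.pi := by
      rw [abs_sub_comm, show w.im - round (w.im / Real.pi) * Real.pi
        = (w.im / Real.pi - round (w.im / Real.pi)) * Real.pi by field_simp, abs_mul,
        abs_of_pos hpi]
      gcongr
    have h3 := Real.pi_lt_four
    simp only [Complex.sub_re, Complex.add_re, Complex.ofReal_re, Complex.mul_re, Complex.I_re,
      mul_zero, Complex.ofReal_im, Complex.I_im, Complex.sub_im, Complex.add_im, Complex.mul_im,
      mul_one, sub_zero, add_zero, zero_add]
    linarith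
  · rw [Complex.cosh_add, Complex.cosh_mul_I, Complex.sinh_mul_I]
    have h1 : Complex.sin ((round (w.im / Real.pi) * Real.pi : ℝ) : ℂ) = 0 := by
      rw [← Complex.ofReal_sin, Real.sin_int_mul_pi]; simp
    have h2 : Complex.cos ((round (w.im / Real.pi) * Real.pi : ℝ) : ℂ) ^ 2 = 1 := by
      have := Complex.sin_sq_add_cos_sq ((round (w.im / Real.pi) * Real.pi : ℝ) : ℂ)
      rw [h1] at this
      simpa using this
    rw [h1, zero_mul, mul_zero, add_zero, mul_pow, h2, mul_one, ← Complex.ofReal_cosh]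
    exact_mod_cast hn

/-- **Landau's theorem** for functions omitting `0` and `1` with a unimodular value at the centre,
with a non-optimal constant. -/
theorem norm_deriv_le_of_omits_zero_one {f : ℂ → ℂ} {c : ℂ} {R : ℝ} (hR : 0 < R)
    (hf : DifferentiableOn ℂ f (Metric.ball c R)) (h0 : ∀ z ∈ Metric.ball c R, f z ≠ 0)
    (h1 : ∀ z ∈ Metric.ball c R, f z ≠ 1) (hc : ‖f c‖ = 1) :
    ‖deriv f c‖ ≤ 1536 * Real.pi / R := by
  have hcm : c ∈ Metric.ball c R := Metric.mem_ball_self hR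
  have hnhds := Metric.isOpen_ball.mem_nhds hcm
  have h2pi : (2 * Real.pi * Complex.I : ℂ) ≠ 0 := Complex.two_pi_I_ne_zero
  have hpi := Real.pi_pos
  obtain ⟨L, hL, hLc, hLf⟩ := exists_log_on_ball hR hf h0 _ (Complex.exp_log (h0 c hcm))
  set F : ℂ → ℂ := fun z => L z / (2 * Real.pi * Complex.I) with hF_def
  have hF : DifferentiableOn ℂ F (Metric.ball c R) := hL.div_const _
  have hFint : ∀ z ∈ Metric.ball c R, ∀ n : ℤ, F z ≠ n := by
    intro z hz n hn
    apply h1 z hz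
    rw [← hLf z hz, Complex.exp_eq_one_iff]
    exact ⟨n, by rw [← hn, hF_def]; field_simp⟩
  have hFc : ‖F c‖ ≤ 1 / 2 := by
    have hlog : ‖L c‖ ≤ Real.pi := by
      rw [hLc]
      refine (Complex.norm_le_abs_re_add_abs_im _).trans ?_
      simp [Complex.log_re, Complex.log_im, hc, Complex.abs_arg_le_pi]
    rw [hF_def]
    simp only [norm_div, norm_mul, Complex.norm_ofNat, Complex.norm_real, Complex.norm_I, mul_one,
      Real.norm_eq_abs, abs_of_pos hpi]
    rw [div_le_iff₀ (by positivity)]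
    linarith
  have hF0 : ∀ z ∈ Metric.ball c R, F z ≠ 0 := fun z hz => by simpa using hFint z hz 0
  have hF1 : ∀ z ∈ Metric.ball c R, F z - 1 ≠ 0 := fun z hz =>
    sub_ne_zero.2 (by simpa using hFint z hz 1)
  obtain ⟨α, hα, -, hαF⟩ := exists_log_on_ball hR hF hF0 _ (Complex.exp_log (hF0 c hcm))
  obtain ⟨β, hβ, -, hβF⟩ :=
    exists_log_on_ball hR (hF.sub_const 1) hF1 _ (Complex.exp_log (hF1 c hcm))
  set A : ℂ → ℂ := fun z => Complex.exp (α z / 2) with hA_def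
  set B : ℂ → ℂ := fun z => Complex.exp (β z / 2) with hB_def
  have hA2 : ∀ z ∈ Metric.ball c R, A z ^ 2 = F z := fun z hz => by
    rw [← hαF z hz, hA_def, ← Complex.exp_nat_mul]; congr 1; push_cast; ring
  have hB2 : ∀ z ∈ Metric.ball c R, B z ^ 2 = F z - 1 := fun z hz => by
    rw [← hβF z hz, hB_def, ← Complex.exp_nat_mul]; congr 1; push_cast; ring
  have hAB : ∀ z ∈ Metric.ball c R, (A z - B z) * (A z + B z) = 1 := fun z hz => by
    linear_combination hA2 z hz - hB2 z hz
  have hAB0 : ∀ z ∈ Metric.ball c R, A z - B z ≠ 0 := fun z hz h => by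
    have := hAB z hz
    rw [h, zero_mul] at this
    exact zero_ne_one this
  have hAd : DifferentiableOn ℂ A (Metric.ball c R) := (hα.div_const 2).cexp
  have hBd : DifferentiableOn ℂ B (Metric.ball c R) := (hβ.div_const 2).cexp
  obtain ⟨H, hH, -, hHF⟩ :=
    exists_log_on_ball hR (hAd.sub hBd) hAB0 _ (Complex.exp_log (hAB0 c hcm))
  have hHneg : ∀ z ∈ Metric.ball c R, Complex.exp (-H z) = A z + B z := fun z hz => by
    have h := hAB z hz
    have h' : Complex.exp (H z) = A z - B z := hHF z hz
    rw [Complex.exp_neg, h']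
    exact inv_eq_of_mul_eq_one_right h
  have hcosh : ∀ z ∈ Metric.ball c R, Complex.cosh (H z) = A z := fun z hz => by
    have h' : Complex.exp (H z) = A z - B z := hHF z hz
    rw [Complex.cosh, hHneg z hz, h']; ring
  have hsinh : Complex.sinh (H c) = -B c := by
    have h' : Complex.exp (H c) = A c - B c := hHF c hcm
    rw [Complex.sinh, hHneg c hcm, h']; ring
  obtain ⟨w, hw⟩ := exists_ball_subset_image_ball hR hH
  have hHc : R * ‖deriv H c‖ / 96 ≤ 4 := by
    by_contra! hlt
    obtain ⟨v, hv, n, hn⟩ := exists_ccosh_sq_eq_int w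
    obtain ⟨z, hz, rfl⟩ := hw (show v ∈ _ by
      simp only [Metric.mem_ball, dist_eq_norm]; linarith)
    rw [hcosh z hz, hA2 z hz] at hn
    exact hFint z hz n hn
  have hFev : f =ᶠ[nhds c] fun z => Complex.exp (2 * Real.pi * Complex.I * Complex.cosh (H z) ^ 2) := by
    filter_upwards [hnhds] with z hz
    rw [hcosh z hz, hA2 z hz, ← hLf z hz, hF_def]
    congr 1
    field_simp
  have hHd := ((hH c hcm).differentiableAt hnhds).hasDerivAt
  have hder := (((hHd.ccosh.pow 2).const_mul (2 * Real.pi * Complex.I : ℂ)).cexp).congr_of_eventuallyEq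
    hFev
  have hfc := hFev.eq_of_nhds
  have hAc : ‖A c‖ ^ 2 ≤ 1 / 2 := by rw [← norm_pow, hA2 c hcm]; exact hFc
  have hBc : ‖B c‖ ^ 2 ≤ 3 / 2 := by
    rw [← norm_pow, hB2 c hcm]
    refine (norm_sub_le _ _).trans ?_
    rw [norm_one]; linarith
  have hABc : ‖A c‖ * ‖B c‖ ≤ 1 := by nlinarith [sq_nonneg (‖A c‖ - ‖B c‖)]
  have hval : ‖deriv f c‖ = 4 * Real.pi * (‖A c‖ * ‖B c‖) * ‖deriv H c‖ := by
    rw [hder.deriv, norm_mul]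
    simp only [Pi.pow_apply] at *
    rw [← hfc, hc, hcosh c hcm, hsinh]
    simp [abs_of_pos hpi]
    ring
  rw [hval, le_div_iff₀ hR]
  have h5 : R * ‖deriv H c‖ ≤ 384 := by linarith
  calc 4 * Real.pi * (‖A c‖ * ‖B c‖) * ‖deriv H c‖ * R
      = 4 * Real.pi * (‖A c‖ * ‖B c‖) * (R * ‖deriv H c‖) := by ring
    _ ≤ 4 * Real.pi * 1 * 384 := by gcongr
    _ = 1536 * Real.pi := by ring
open Filter Topology

/-- The Ising recursion in the square-root coordinates `ℓ ^ 2 = z⁻¹`, `x ^ 2 = Z_n^0 / Z_n^1`. -/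
def isingMap {K : Type*} [Field K] (t ℓ x : K) : K := ℓ * (x ^ 2 + t) / (t * x ^ 2 + 1)

/-- The difference quotient of `isingMap t ℓ` between `x` and `y`. -/
def isingSlope {K : Type*} [Field K] (t ℓ x y : K) : K :=
  ℓ * (1 - t ^ 2) * (x + y) / ((t * x ^ 2 + 1) * (t * y ^ 2 + 1))

/-- The orbit of the marked point `ℓ` under `isingMap t ℓ`. -/
def isingOrbit {K : Type*} [Field K] (t ℓ : K) : ℕ → K
  | 0 => ℓ
  | n + 1 => isingMap t ℓ (isingOrbit t ℓ n)

/-- The discriminant polynomial whose sign decides whether a real two-cycle exists. -/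
def isingDisc (t r : ℝ) : ℝ := 4 * t * r ^ 2 - (t ^ 4 - 6 * t ^ 2 - 3) * r + 4 * t

theorem isingMap_sub {K : Type*} [Field K] {t ℓ x y : K} (hx : t * x ^ 2 + 1 ≠ 0)
    (hy : t * y ^ 2 + 1 ≠ 0) :
    isingMap t ℓ x - isingMap t ℓ y = (x - y) * isingSlope t ℓ x y := by
  unfold isingMap isingSlope
  rw [div_sub_div _ _ hx hy, ← mul_div_assoc]
  congr 1
  ring

theorem ofReal_isingMap (t ℓ x : ℝ) :
    ((isingMap t ℓ x : ℝ) : ℂ) = isingMap (t : ℂ) ℓ x := by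
  simp [isingMap]

theorem ofReal_isingSlope (t ℓ x y : ℝ) :
    ((isingSlope t ℓ x y : ℝ) : ℂ) = isingSlope (t : ℂ) ℓ x y := by
  simp [isingSlope]

theorem ofReal_isingOrbit (t ℓ : ℝ) (n : ℕ) :
    ((isingOrbit t ℓ n : ℝ) : ℂ) = isingOrbit (t : ℂ) ℓ n := by
  induction n with
  | zero => rfl
  | succ n ih => rw [isingOrbit, ofReal_isingMap, ih, isingOrbit]

section Real

variable {t ℓ : ℝ}

theorem isingMap_pos (ht : 1 < t) (hℓ : 0 < ℓ) (x : ℝ) : 0 < isingMap t ℓ x := by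
  unfold isingMap; positivity

theorem isingMap_le (ht : 1 < t) (hℓ : 0 < ℓ) (x : ℝ) : isingMap t ℓ x ≤ ℓ * t := by
  unfold isingMap
  rw [div_le_iff₀ (by positivity)]
  have : x ^ 2 + t ≤ t * (t * x ^ 2 + 1) := by
    nlinarith [mul_nonneg (by nlinarith : 0 ≤ t ^ 2 - 1) (sq_nonneg x)]
  nlinarith

theorem le_isingMap (ht : 1 < t) (hℓ : 0 < ℓ) (x : ℝ) : ℓ / t ≤ isingMap t ℓ x := by
  unfold isingMap
  rw [div_le_div_iff₀ (by positivity) (by positivity)]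
  have : t * x ^ 2 + 1 ≤ (x ^ 2 + t) * t := by nlinarith
  nlinarith

theorem isingOrbit_pos (ht : 1 < t) (hℓ : 0 < ℓ) (n : ℕ) : 0 < isingOrbit t ℓ n := by
  cases n with
  | zero => exact hℓ
  | succ n => exact isingMap_pos ht hℓ _

theorem isingOrbit_le (ht : 1 < t) (hℓ : 0 < ℓ) (n : ℕ) : isingOrbit t ℓ n ≤ ℓ * t := by
  cases n with
  | zero => simp only [isingOrbit]; nlinarith
  | succ n => exact isingMap_le ht hℓ _

theorem le_isingOrbit (ht : 1 < t) (hℓ : 0 < ℓ) (n : ℕ) : ℓ / t ≤ isingOrbit t ℓ n := by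
  cases n with
  | zero => exact div_le_self hℓ.le ht.le
  | succ n => exact le_isingMap ht hℓ _

theorem isingSlope_neg (ht : 1 < t) (hℓ : 0 < ℓ) {x y : ℝ} (hx : 0 < x) (hy : 0 < y) :
    isingSlope t ℓ x y < 0 := by
  unfold isingSlope
  refine div_neg_of_neg_of_pos ?_ (by positivity)
  have : 0 < ℓ * (t ^ 2 - 1) * (x + y) := by
    have : 0 < t ^ 2 - 1 := by nlinarith
    positivity
  linarith

theorem isingMap_sub_real (ht : 1 < t) (x y : ℝ) :
    isingMap t ℓ x - isingMap t ℓ y = (x - y) * isingSlope t ℓ x y :=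
  isingMap_sub (by positivity) (by positivity)

theorem isingMap_injOn (ht : 1 < t) (hℓ : 0 < ℓ) {x y : ℝ} (hx : 0 < x) (hy : 0 < y)
    (h : isingMap t ℓ x = isingMap t ℓ y) : x = y := by
  have h1 := isingMap_sub_real (ℓ := ℓ) ht x y
  rw [h, sub_self] at h1
  exact sub_eq_zero.1 ((mul_eq_zero.1 h1.symm).resolve_right (isingSlope_neg ht hℓ hx hy).ne)

theorem isingMap_antitone (ht : 1 < t) (hℓ : 0 < ℓ) {x y : ℝ} (hx : 0 < x) (hxy : x ≤ y) :
    isingMap t ℓ y ≤ isingMap t ℓ x := by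
  have h1 := isingMap_sub_real (ℓ := ℓ) ht x y
  nlinarith [isingSlope_neg ht hℓ hx (hx.trans_le hxy)]

theorem continuous_isingMap (ht : 1 < t) : Continuous (isingMap t ℓ) := by
  unfold isingMap
  exact Continuous.div (by fun_prop) (by fun_prop) (fun x => by positivity)

theorem continuous_isingSlope (ht : 1 < t) :
    Continuous fun p : ℝ × ℝ => isingSlope t ℓ p.1 p.2 := by
  unfold isingSlope
  exact Continuous.div (by fun_prop) (by fun_prop) (fun x => by positivity)

theorem exists_tendsto_isingOrbit_even (ht : 1 < t) (hℓ : 0 < ℓ) :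
    ∃ P, 0 < P ∧ P ≤ ℓ * t ∧ Tendsto (fun n => isingOrbit t ℓ (2 * n)) atTop (𝓝 P) ∧
      isingMap t ℓ (isingMap t ℓ P) = P := by
  have hex : ∃ P, Tendsto (fun n => isingOrbit t ℓ (2 * n)) atTop (𝓝 P) := by
    have step : ∀ x y : ℝ, 0 < x → x ≤ y →
        isingMap t ℓ (isingMap t ℓ x) ≤ isingMap t ℓ (isingMap t ℓ y) := fun x y hx hxy =>
      isingMap_antitone ht hℓ (isingMap_pos ht hℓ _) (isingMap_antitone ht hℓ hx hxy)
    rcases le_total (isingOrbit t ℓ (2 * 0)) (isingOrbit t ℓ (2 * (0 + 1))) with h | h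
    · refine ⟨_, tendsto_atTop_ciSup (monotone_nat_of_le_succ fun n => ?_)
        ⟨ℓ * t, by rintro _ ⟨n, rfl⟩; exact isingOrbit_le ht hℓ _⟩⟩
      induction n with
      | zero => exact h
      | succ n ih => exact step _ _ (isingOrbit_pos ht hℓ _) ih
    · refine ⟨_, tendsto_atTop_ciInf (antitone_nat_of_succ_le fun n => ?_)
        ⟨ℓ / t, by rintro _ ⟨n, rfl⟩; exact le_isingOrbit ht hℓ _⟩⟩
      induction n with
      | zero => exact h
      | succ n ih => exact step _ _ (isingOrbit_pos ht hℓ _) ih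
  obtain ⟨P, hP⟩ := hex
  refine ⟨P, lt_of_lt_of_le (by positivity : 0 < ℓ / t)
    (ge_of_tendsto' hP fun n => le_isingOrbit ht hℓ _),
    le_of_tendsto' hP fun n => isingOrbit_le ht hℓ _, hP, ?_⟩
  have h1 := (((continuous_isingMap (ℓ := ℓ) ht).comp
    (continuous_isingMap (ℓ := ℓ) ht)).tendsto P).comp hP
  exact tendsto_nhds_unique h1 (hP.comp (tendsto_add_atTop_nat 1))

/-- An orbit that converges to a repelling two-periodic point starts at a fixed point. -/
theorem multiplier_le_one_of_tendsto (ht : 1 < t) (hℓ : 0 < ℓ) (h13 : ℓ ≠ 1 ∨ t ≤ 3) {P : ℝ}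
    (hP : 0 < P) (hlim : Tendsto (fun n => isingOrbit t ℓ (2 * n)) atTop (𝓝 P))
    (hper : isingMap t ℓ (isingMap t ℓ P) = P) (hfix : isingMap t ℓ P = P) :
    isingSlope t ℓ P P * isingSlope t ℓ (isingMap t ℓ P) (isingMap t ℓ P) ≤ 1 := by
  by_contra! hM
  set u := fun n => isingOrbit t ℓ (2 * n) with hu
  have hupos : ∀ n, 0 < u n := fun n => isingOrbit_pos ht hℓ _
  have hrec : ∀ n, u (n + 1) - P = (u n - P) * (isingSlope t ℓ (u n) P *
      isingSlope t ℓ (isingMap t ℓ (u n)) (isingMap t ℓ P)) := fun n => by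
    rw [← mul_assoc, ← isingMap_sub_real ht, ← isingMap_sub_real ht, hper]; rfl
  have hmul : Tendsto (fun n => isingSlope t ℓ (u n) P *
      isingSlope t ℓ (isingMap t ℓ (u n)) (isingMap t ℓ P)) atTop
      (𝓝 (isingSlope t ℓ P P * isingSlope t ℓ (isingMap t ℓ P) (isingMap t ℓ P))) := by
    have hc : Continuous fun x => isingSlope t ℓ x P *
        isingSlope t ℓ (isingMap t ℓ x) (isingMap t ℓ P) :=
      ((continuous_isingSlope ht).comp (continuous_id.prodMk continuous_const)).mul
        ((continuous_isingSlope ht).comp ((continuous_isingMap ht).prodMk continuous_const))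
    exact (hc.tendsto P).comp hlim
  obtain ⟨N, hN⟩ := eventually_atTop.1 (hmul.eventually (lt_mem_nhds hM))
  have hgrow : ∀ n, |u N - P| ≤ |u (N + n) - P| := fun n => by
    induction n with
    | zero => rfl
    | succ n ih =>
      refine ih.trans ?_
      rw [← add_assoc, hrec, abs_mul]
      exact le_mul_of_one_le_right (abs_nonneg _)
        ((hN (N + n) (by omega)).le.trans (le_abs_self _))
  have hzero : |u N - P| ≤ 0 := by
    have h1 : Tendsto (fun n => |u (N + n) - P|) atTop (𝓝 0) := by
      have := ((hlim.sub_const P).abs).comp (tendsto_add_atTop_nat N)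
      simpa [Function.comp_def, add_comm] using this
    exact ge_of_tendsto' h1 hgrow
  have hback : ∀ n, u n = P → u 0 = P := fun n => by
    induction n with
    | zero => exact id
    | succ n ih =>
      intro h
      refine ih (isingMap_injOn ht hℓ (hupos n) hP
        (isingMap_injOn ht hℓ (isingMap_pos ht hℓ _) (isingMap_pos ht hℓ _) ?_))
      rw [hper]; exact h
  have h0 : ℓ = P := hback N (sub_eq_zero.1 (abs_nonpos_iff.1 hzero))
  subst h0
  have hℓ1 : ℓ = 1 := by
    unfold isingMap at hfix
    rw [div_eq_iff (by positivity)] at hfix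
    have h2 : (t - 1) * ((ℓ - 1) * (ℓ + 1)) = 0 := by
      have := mul_left_cancel₀ hℓ.ne' hfix
      linear_combination -this
    rcases mul_eq_zero.1 h2 with h | h
    · linarith
    · rcases mul_eq_zero.1 h with h | h <;> linarith
  subst hℓ1
  have ht3 : t ≤ 3 := h13.resolve_left (by simp)
  rw [hfix] at hM
  have hS : isingSlope t 1 1 1 = -(2 * (t - 1) / (t + 1)) := by
    unfold isingSlope; field_simp; ring
  rw [hS, neg_mul_neg, ← sq] at hM
  have : 2 * (t - 1) / (t + 1) ≤ 1 := by rw [div_le_one (by linarith)]; linarith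
  have h0 : 0 ≤ 2 * (t - 1) / (t + 1) := div_nonneg (by linarith) (by linarith)
  nlinarith

theorem isingSlope_of_fixed (ht : 1 < t) {P : ℝ} (hP : 0 < P) (hfix : isingMap t ℓ P = P) :
    isingSlope t ℓ P P = -(2 * P ^ 2 * (t ^ 2 - 1) / ((P ^ 2 + t) * (t * P ^ 2 + 1))) := by
  unfold isingMap at hfix
  have hl : ℓ = P * (t * P ^ 2 + 1) / (P ^ 2 + t) := by
    field_simp at hfix ⊢; linear_combination hfix
  unfold isingSlope
  rw [hl]; field_simp; ring

theorem isingDisc_of_fixed (ht : 1 < t) {P : ℝ} (hP : 0 < P) (hfix : isingMap t ℓ P = P) :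
    isingDisc t (ℓ ^ 2) * (P ^ 2 + t) ^ 4 =
      (t * (P ^ 2) ^ 2 + (3 - t ^ 2) * P ^ 2 + t) * (4 * t ^ 4 * (P ^ 2) ^ 4 +
        t * (3 * t ^ 2 + 1) * (t ^ 2 + 3) * (P ^ 2) ^ 3 +
        (t ^ 6 + 7 * t ^ 4 + 15 * t ^ 2 + 1) * (P ^ 2) ^ 2 +
        t * (3 * t ^ 2 + 1) * (t ^ 2 + 3) * P ^ 2 + 4 * t ^ 4) := by
  unfold isingMap at hfix
  have hl : ℓ = P * (t * P ^ 2 + 1) / (P ^ 2 + t) := by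
    field_simp at hfix ⊢; linear_combination hfix
  unfold isingDisc
  rw [hl]; field_simp; ring

theorem two_cycle_sum_prod {P R : ℝ} (ht : 1 < t) (hPR : P ≠ R)
    (h1 : isingMap t ℓ P = R) (h2 : isingMap t ℓ R = P) :
    (t + ℓ ^ 2) * (P + R) = ℓ * (t ^ 2 - 1) ∧ (t + ℓ ^ 2) * (P * R) = 1 + ℓ ^ 2 * t ∧
      t * (P * R) = 1 + ℓ * (P + R) := by
  unfold isingMap at h1 h2
  rw [div_eq_iff (by positivity)] at h1 h2
  have ha : t * (P * R) = 1 + ℓ * (P + R) := by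
    have : (P - R) * (t * (P * R) - (1 + ℓ * (P + R))) = 0 := by linear_combination h2 - h1
    exact sub_eq_zero.1 ((mul_eq_zero.1 this).resolve_left (sub_ne_zero.2 hPR))
  have hb : P + R = ℓ * (t - P * R) := by
    linear_combination -(h1 + h2) / 2 - (P + R) / 2 * ha
  exact ⟨by linear_combination t * hb - ℓ * ha, by linear_combination ha + ℓ * hb, ha⟩

theorem two_cycle_multiplier_lt_one {P R : ℝ} (ht : 1 < t) (hℓ : 0 < ℓ) (hP : 0 < P) (hR : 0 < R)
    (hPR : P ≠ R) (h1 : isingMap t ℓ P = R) (h2 : isingMap t ℓ R = P) :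
    isingSlope t ℓ P P * isingSlope t ℓ R R < 1 := by
  obtain ⟨hs, hp, ha⟩ := two_cycle_sum_prod ht hPR h1 h2
  have hden : (t * P ^ 2 + 1) * (t * R ^ 2 + 1) = (t + ℓ ^ 2) * (P + R) ^ 2 := by
    linear_combination (t * (P * R) - 1 + ℓ * (P + R)) * ha
  have hM : isingSlope t ℓ P P * isingSlope t ℓ R R =
      (ℓ * (t ^ 2 - 1)) ^ 2 * (4 * (P * R)) / ((t * P ^ 2 + 1) * (t * R ^ 2 + 1)) ^ 2 := by
    unfold isingSlope; field_simp; ring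
  rw [hM, hden, ← hs, div_lt_one (by positivity)]
  have h4 : 4 * (P * R) < (P + R) ^ 2 := by
    nlinarith [sq_pos_of_pos (abs_pos.2 (sub_ne_zero.2 hPR)), sq_abs (P - R)]
  calc ((t + ℓ ^ 2) * (P + R)) ^ 2 * (4 * (P * R))
      < ((t + ℓ ^ 2) * (P + R)) ^ 2 * (P + R) ^ 2 := by gcongr
    _ = _ := by ring

theorem isingDisc_neg_of_two_cycle {P R : ℝ} (ht : 1 < t) (hPR : P ≠ R)
    (h1 : isingMap t ℓ P = R) (h2 : isingMap t ℓ R = P) : isingDisc t (ℓ ^ 2) < 0 := by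
  obtain ⟨hs, hp, -⟩ := two_cycle_sum_prod ht hPR h1 h2
  have h : isingDisc t (ℓ ^ 2) = -((t + ℓ ^ 2) * (P - R)) ^ 2 := by
    unfold isingDisc
    linear_combination ((t + ℓ ^ 2) * (P + R) + ℓ * (t ^ 2 - 1)) * hs -
      4 * (t + ℓ ^ 2) * hp
  rw [h, neg_lt_zero]
  have := sub_ne_zero.2 hPR
  positivity

/-- The sign of the discriminant is the sign of `1 - multiplier` at the positive fixed point. -/
theorem isingDisc_sign_of_fixed (ht : 1 < t) {P : ℝ} (hP : 0 < P) (hfix : isingMap t ℓ P = P)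
    (hM : isingSlope t ℓ P P * isingSlope t ℓ P P ≤ 1) :
    0 ≤ isingDisc t (ℓ ^ 2) ∧ (isingDisc t (ℓ ^ 2) ≠ 0 →
      isingSlope t ℓ P P * isingSlope t ℓ P P < 1) ∧
    (isingDisc t (ℓ ^ 2) = 0 → (t + ℓ ^ 2) * (2 * P) = ℓ * (t ^ 2 - 1)) := by
  have hD := isingDisc_of_fixed ht hP hfix
  have ht2 : 0 < t ^ 2 - 1 := by nlinarith
  have hS := isingSlope_of_fixed ht hP hfix
  set m := 2 * P ^ 2 * (t ^ 2 - 1) / ((P ^ 2 + t) * (t * P ^ 2 + 1)) with hm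
  have hm0 : 0 < m := by positivity
  rw [hS, neg_mul_neg] at hM ⊢
  have hdm : t * (P ^ 2) ^ 2 + (3 - t ^ 2) * P ^ 2 + t =
      (1 - m) * ((P ^ 2 + t) * (t * P ^ 2 + 1)) := by
    rw [hm]; field_simp; ring
  have hm1 : m ≤ 1 := by nlinarith
  set q := 4 * t ^ 4 * (P ^ 2) ^ 4 + t * (3 * t ^ 2 + 1) * (t ^ 2 + 3) * (P ^ 2) ^ 3 +
        (t ^ 6 + 7 * t ^ 4 + 15 * t ^ 2 + 1) * (P ^ 2) ^ 2 +
        t * (3 * t ^ 2 + 1) * (t ^ 2 + 3) * P ^ 2 + 4 * t ^ 4 with hq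
  have hq0 : 0 < q := by positivity
  rw [hdm] at hD
  refine ⟨?_, fun hne => ?_, fun h0 => ?_⟩
  · have : 0 ≤ isingDisc t (ℓ ^ 2) * (P ^ 2 + t) ^ 4 := by
      rw [hD]; have : 0 ≤ 1 - m := by linarith
      positivity
    exact nonneg_of_mul_nonneg_left this (by positivity)
  · have : m ≠ 1 := fun h => hne (by
      rw [h, sub_self, zero_mul, zero_mul] at hD
      exact (mul_eq_zero.1 hD).resolve_right (by positivity))
    have := lt_of_le_of_ne hm1 this
    nlinarith
  · rw [h0, zero_mul] at hD
    have hd : t * (P ^ 2) ^ 2 + (3 - t ^ 2) * P ^ 2 + t = 0 := by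
      rw [hdm]; exact (mul_eq_zero.1 hD.symm).resolve_right hq0.ne'
    unfold isingMap at hfix
    have hl : ℓ = P * (t * P ^ 2 + 1) / (P ^ 2 + t) := by
      field_simp at hfix ⊢; linear_combination hfix
    rw [hl]
    field_simp
    linear_combination (2 * t * P ^ 2 + 1 + t ^ 2) * hd

end Real

section Passive

variable {t ℓ₀ : ℝ}

theorem exists_limit_isingOrbit_even (ht : 1 < t) (hℓ : 0 < ℓ₀) (h13 : ℓ₀ ≠ 1 ∨ t ≤ 3) :
    ∃ P, 0 < P ∧ P ≤ ℓ₀ * t ∧ Tendsto (fun n => isingOrbit t ℓ₀ (2 * n)) atTop (𝓝 P) ∧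
      isingMap t ℓ₀ (isingMap t ℓ₀ P) = P ∧
      (isingDisc t (ℓ₀ ^ 2) ≠ 0 →
        isingSlope t ℓ₀ P P * isingSlope t ℓ₀ (isingMap t ℓ₀ P) (isingMap t ℓ₀ P) < 1) ∧
      (isingDisc t (ℓ₀ ^ 2) < 0 →
        (t + ℓ₀ ^ 2) * P ^ 2 - ℓ₀ * (t ^ 2 - 1) * P + 1 + ℓ₀ ^ 2 * t = 0) ∧
      (isingDisc t (ℓ₀ ^ 2) = 0 → (t + ℓ₀ ^ 2) * (2 * P) = ℓ₀ * (t ^ 2 - 1)) := by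
  obtain ⟨P, hP, hPle, hlim, hper⟩ := exists_tendsto_isingOrbit_even ht hℓ
  refine ⟨P, hP, hPle, hlim, hper, ?_⟩
  by_cases hfix : isingMap t ℓ₀ P = P
  · have hM := multiplier_le_one_of_tendsto ht hℓ h13 hP hlim hper hfix
    rw [hfix] at hM ⊢
    obtain ⟨h1, h2, h3⟩ := isingDisc_sign_of_fixed ht hP hfix hM
    exact ⟨h2, fun h => absurd h h1.not_gt, h3⟩
  · have hD := isingDisc_neg_of_two_cycle ht (Ne.symm hfix) rfl hper
    refine ⟨fun _ => two_cycle_multiplier_lt_one ht hℓ hP (isingMap_pos ht hℓ _) (Ne.symm hfix)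
      rfl hper, fun _ => ?_, fun h => absurd h hD.ne⟩
    obtain ⟨hs, hp, -⟩ := two_cycle_sum_prod ht (Ne.symm hfix) rfl hper
    linear_combination P * hs - hp

theorem ofReal_sq_add_one_ne_zero (ht : 1 < t) (x : ℝ) : (t : ℂ) * (x : ℂ) ^ 2 + 1 ≠ 0 := by
  have : t * x ^ 2 + 1 ≠ 0 := by positivity
  exact_mod_cast this

theorem sq_add_one_ne_zero_of_re_pos (ht : 1 < t) {x : ℂ} (hx : 0 < (x ^ 2).re) :
    (t : ℂ) * x ^ 2 + 1 ≠ 0 := by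
  intro h
  have h1 := congrArg Complex.re h
  rw [Complex.add_re, Complex.re_ofReal_mul, Complex.one_re, Complex.zero_re] at h1
  nlinarith

theorem continuousAt_isingMap {p : ℂ × ℂ} (hp : (t : ℂ) * p.2 ^ 2 + 1 ≠ 0) :
    ContinuousAt (fun p : ℂ × ℂ => isingMap (t : ℂ) p.1 p.2) p := by
  unfold isingMap
  exact ContinuousAt.div (by fun_prop) (by fun_prop) hp

theorem continuousAt_isingOrbit (ht : 1 < t) (n : ℕ) :
    ContinuousAt (fun ℓ : ℂ => isingOrbit (t : ℂ) ℓ n) ℓ₀ := by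
  induction n with
  | zero => exact continuousAt_id
  | succ n ih =>
    have h : ContinuousAt (fun p : ℂ × ℂ => isingMap (t : ℂ) p.1 p.2)
        ((ℓ₀ : ℂ), isingOrbit (t : ℂ) ℓ₀ n) := continuousAt_isingMap (by
      rw [← ofReal_isingOrbit]; exact ofReal_sq_add_one_ne_zero ht _)
    exact ContinuousAt.comp (f := fun ℓ : ℂ => (ℓ, isingOrbit (t : ℂ) ℓ n)) h
      (continuousAt_id.prodMk ih)

theorem isOpen_re_sq_pos : IsOpen {x : ℂ | 0 < (x ^ 2).re} :=
  isOpen_lt continuous_const (Complex.continuous_re.comp (continuous_pow 2))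

theorem ofReal_re_sq_pos {x : ℝ} (hx : 0 < x) : 0 < ((x : ℂ) ^ 2).re := by
  rw [← Complex.ofReal_pow, Complex.ofReal_re]; positivity

/-- Convergence of the marked orbit to an attracting two-periodic point persists for complex
parameters, so that the whole orbit stays in a sector around the positive axis. -/
theorem eventually_forall_re_sq_isingOrbit_pos (ht : 1 < t) (hℓ : 0 < ℓ₀) {P : ℝ} (hP : 0 < P)
    (hlim : Tendsto (fun n => isingOrbit t ℓ₀ (2 * n)) atTop (𝓝 P))
    (hper : isingMap t ℓ₀ (isingMap t ℓ₀ P) = P)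
    (hM : isingSlope t ℓ₀ P P * isingSlope t ℓ₀ (isingMap t ℓ₀ P) (isingMap t ℓ₀ P) < 1) :
    ∀ᶠ ℓ : ℂ in 𝓝 ↑ℓ₀, ∀ n, 0 < ((isingOrbit (t : ℂ) ℓ n) ^ 2).re := by
  have hR : 0 < isingMap t ℓ₀ P := isingMap_pos ht hℓ P
  set R := isingMap t ℓ₀ P with hRdef
  have hPc := ofReal_sq_add_one_ne_zero ht P
  have hRc := ofReal_sq_add_one_ne_zero ht R
  have hEP : isingMap (t : ℂ) ℓ₀ P = R := (ofReal_isingMap t ℓ₀ P).symm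
  have hER : isingMap (t : ℂ) ℓ₀ R = P := by rw [← ofReal_isingMap, hper]
  have hM0 : 0 < isingSlope t ℓ₀ P P * isingSlope t ℓ₀ R R :=
    mul_pos_of_neg_of_neg (isingSlope_neg ht hℓ hP hP) (isingSlope_neg ht hℓ hR hR)
  obtain ⟨k, hk, hk1⟩ := exists_between hM
  have hk0 : 0 < k := hM0.trans hk
  set p₀ : ℂ × ℂ := (↑ℓ₀, ↑P) with hp₀
  have c1 : ContinuousAt (fun p : ℂ × ℂ => isingMap (t : ℂ) p.1 p.2) p₀ :=
    continuousAt_isingMap hPc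
  have c2 : ContinuousAt (fun p : ℂ × ℂ => isingMap (t : ℂ) p.1 P) p₀ :=
    ContinuousAt.comp (g := fun p : ℂ × ℂ => isingMap (t : ℂ) p.1 p.2)
      (f := fun p : ℂ × ℂ => (p.1, (P : ℂ))) (continuousAt_isingMap hPc) (by fun_prop)
  have s1 : ContinuousAt (fun p : ℂ × ℂ => isingSlope (t : ℂ) p.1 p.2 P) p₀ := by
    unfold isingSlope
    exact ContinuousAt.div (by fun_prop) (by fun_prop) (mul_ne_zero hPc hPc)
  have s2 : ContinuousAt (fun p : ℂ × ℂ => isingSlope (t : ℂ) p.1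
      (isingMap (t : ℂ) p.1 p.2) (isingMap (t : ℂ) p.1 P)) p₀ := by
    unfold isingSlope
    refine ContinuousAt.div ?_ ?_ ?_
    · exact (continuousAt_fst.mul continuousAt_const).mul (c1.add c2)
    · exact ((continuousAt_const.mul (c1.pow 2)).add continuousAt_const).mul
        ((continuousAt_const.mul (c2.pow 2)).add continuousAt_const)
    · simp only [hp₀, hEP]; exact mul_ne_zero hRc hRc
  have hslope : ∀ᶠ p in 𝓝 p₀, ‖isingSlope (t : ℂ) p.1 p.2 P * isingSlope (t : ℂ) p.1
      (isingMap (t : ℂ) p.1 p.2) (isingMap (t : ℂ) p.1 P)‖ < k := by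
    refine (s1.mul s2).norm.eventually_lt continuousAt_const ?_
    simp only [hp₀, Pi.mul_apply, hEP]
    rw [← ofReal_isingSlope, ← ofReal_isingSlope, ← Complex.ofReal_mul, Complex.norm_real,
      Real.norm_eq_abs, abs_of_pos hM0]
    exact hk
  have w1 : ∀ᶠ p in 𝓝 p₀, 0 < (p.2 ^ 2).re :=
    (continuousAt_snd (p := p₀)).eventually (isOpen_re_sq_pos.mem_nhds (ofReal_re_sq_pos hP))
  have w2 : ∀ᶠ p in 𝓝 p₀, 0 < ((isingMap (t : ℂ) p.1 p.2) ^ 2).re :=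
    c1.eventually (isOpen_re_sq_pos.mem_nhds (by
      simp only [hp₀, hEP]; exact ofReal_re_sq_pos hR))
  have w3 : ∀ᶠ p in 𝓝 p₀, 0 < ((isingMap (t : ℂ) p.1 P) ^ 2).re :=
    c2.eventually (isOpen_re_sq_pos.mem_nhds (by
      simp only [hp₀, hEP]; exact ofReal_re_sq_pos hR))
  obtain ⟨r, hr, hball⟩ := Metric.eventually_nhds_iff.1 (hslope.and (w1.and (w2.and w3)))
  have hin : ∀ ℓ x : ℂ, dist ℓ ℓ₀ < r → dist x P < r → dist (ℓ, x) p₀ < r := fun ℓ x h1 h2 =>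
    max_lt h1 h2
  have hΦ : ∀ᶠ ℓ : ℂ in 𝓝 ↑ℓ₀,
      dist (isingMap (t : ℂ) ℓ (isingMap (t : ℂ) ℓ P)) P < (1 - k) * r := by
    have d1 : ContinuousAt (fun ℓ : ℂ => isingMap (t : ℂ) ℓ P) ℓ₀ :=
      ContinuousAt.comp (g := fun p : ℂ × ℂ => isingMap (t : ℂ) p.1 p.2)
        (f := fun ℓ : ℂ => (ℓ, (P : ℂ))) (continuousAt_isingMap hPc) (by fun_prop)
    have d2 : ContinuousAt (fun ℓ : ℂ => isingMap (t : ℂ) ℓ (isingMap (t : ℂ) ℓ P)) ℓ₀ :=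
      ContinuousAt.comp (g := fun p : ℂ × ℂ => isingMap (t : ℂ) p.1 p.2)
        (f := fun ℓ : ℂ => (ℓ, isingMap (t : ℂ) ℓ P))
        (continuousAt_isingMap (by simp only [hEP]; exact hRc)) (continuousAt_id.prodMk d1)
    refine d2.eventually ((Metric.isOpen_ball (x := (P : ℂ)) (ε := (1 - k) * r)).mem_nhds ?_)
    simp only [hEP, hER]
    exact Metric.mem_ball_self (mul_pos (by linarith) hr)
  obtain ⟨N, hN⟩ := (hlim.eventually (Metric.ball_mem_nhds P hr)).exists
  have hNev : ∀ᶠ ℓ : ℂ in 𝓝 ↑ℓ₀, dist (isingOrbit (t : ℂ) ℓ (2 * N)) P < r := by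
    refine (continuousAt_isingOrbit ht (2 * N)).eventually
      ((Metric.isOpen_ball (x := (P : ℂ)) (ε := r)).mem_nhds ?_)
    beta_reduce
    rw [← ofReal_isingOrbit, Metric.mem_ball, Complex.dist_eq, ← Complex.ofReal_sub,
      Complex.norm_real, ← dist_eq_norm]
    exact hN
  have hfin : ∀ᶠ ℓ : ℂ in 𝓝 ↑ℓ₀, ∀ n ∈ Finset.range (2 * N),
      0 < ((isingOrbit (t : ℂ) ℓ n) ^ 2).re := by
    refine (Finset.eventually_all _).2 fun n _ => (continuousAt_isingOrbit ht n).eventually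
      (isOpen_re_sq_pos.mem_nhds ?_)
    beta_reduce
    rw [← ofReal_isingOrbit]
    exact ofReal_re_sq_pos (isingOrbit_pos ht hℓ n)
  filter_upwards [hfin, hNev, hΦ, Metric.ball_mem_nhds _ hr] with ℓ h1 h2 h3 h4
  have hstay : ∀ n, dist (isingOrbit (t : ℂ) ℓ (2 * (N + n))) P < r := fun n => by
    induction n with
    | zero => exact h2
    | succ n ih =>
      obtain ⟨b1, b2, b3, b4⟩ := hball (hin ℓ _ h4 ih)
      set x := isingOrbit (t : ℂ) ℓ (2 * (N + n))
      have hx : isingOrbit (t : ℂ) ℓ (2 * (N + (n + 1))) =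
        isingMap (t : ℂ) ℓ (isingMap (t : ℂ) ℓ x) := rfl
      have hsub : isingMap (t : ℂ) ℓ (isingMap (t : ℂ) ℓ x) -
          isingMap (t : ℂ) ℓ (isingMap (t : ℂ) ℓ P) = (x - P) *
          (isingSlope (t : ℂ) ℓ x P * isingSlope (t : ℂ) ℓ (isingMap (t : ℂ) ℓ x)
            (isingMap (t : ℂ) ℓ P)) := by
        rw [isingMap_sub (sq_add_one_ne_zero_of_re_pos ht b3) (sq_add_one_ne_zero_of_re_pos ht b4),
          isingMap_sub (sq_add_one_ne_zero_of_re_pos ht b2) hPc, mul_assoc]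
      have hd : dist (isingMap (t : ℂ) ℓ (isingMap (t : ℂ) ℓ x))
          (isingMap (t : ℂ) ℓ (isingMap (t : ℂ) ℓ P)) ≤ r * k := by
        rw [dist_eq_norm, hsub, norm_mul, ← dist_eq_norm]
        exact mul_le_mul ih.le b1.le (norm_nonneg _) hr.le
      rw [hx]
      have := dist_triangle (isingMap (t : ℂ) ℓ (isingMap (t : ℂ) ℓ x))
        (isingMap (t : ℂ) ℓ (isingMap (t : ℂ) ℓ P)) P
      nlinarith
  intro n
  rcases lt_or_ge n (2 * N) with hn | hn
  · exact h1 n (Finset.mem_range.2 hn)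
  · obtain ⟨m, hm | hm⟩ : ∃ m, n = 2 * (N + m) ∨ n = 2 * (N + m) + 1 :=
      ⟨(n - 2 * N) / 2, by omega⟩
    · rw [hm]; exact (hball (hin ℓ _ h4 (hstay m))).2.1
    · rw [hm]; exact (hball (hin ℓ _ h4 (hstay m))).2.2.1

end Passive

/-- Homogeneous coordinates of `isingOrbit`, polynomial in the parameter. -/
def isingPair (t : ℂ) (ℓ : ℂ) : ℕ → ℂ × ℂ
  | 0 => (ℓ, 1)
  | n + 1 => (ℓ * ((isingPair t ℓ n).1 ^ 2 + t * (isingPair t ℓ n).2 ^ 2),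
      t * (isingPair t ℓ n).1 ^ 2 + (isingPair t ℓ n).2 ^ 2)

/-- The zeros of the partition functions in the parameter `ℓ` with `ℓ ^ 2 = z⁻¹`. -/
def isingZeros (t : ℝ) : Set ℂ :=
  {ℓ | ∃ n, (isingPair t ℓ n).1 ^ 2 + (isingPair t ℓ n).2 ^ 2 = 0}

theorem ZZpair_two_eq (t : ℝ) {z ℓ : ℂ} (h : z⁻¹ = ℓ ^ 2) (n : ℕ) :
    ZZpair 2 t n z = ((isingPair t ℓ n).1 ^ 2, (isingPair t ℓ n).2 ^ 2) := by
  induction n with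
  | zero => simp [ZZpair, isingPair, h]
  | succ n ih =>
    simp only [ZZpair, isingPair, ih, h, Prod.mk.injEq]
    constructor <;> push_cast <;> ring

theorem Zrooted_two_eq (t : ℝ) {z ℓ : ℂ} (h : z⁻¹ = ℓ ^ 2) (n : ℕ) :
    Zrooted 2 t n z = (isingPair t ℓ n).1 ^ 2 + (isingPair t ℓ n).2 ^ 2 := by
  rw [Zrooted, ZZpair_two_eq t h]
  push_cast
  ring

theorem mem_BLY_two_iff (t : ℝ) {ℓ₀ : ℝ} (hℓ : 0 < ℓ₀) :
    (((ℓ₀ ^ 2)⁻¹ : ℝ) : ℂ) ∈ BLY t 2 ↔ (ℓ₀ : ℂ) ∈ closure (isingZeros t) := by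
  have hℓc : (ℓ₀ : ℂ) ≠ 0 := by exact_mod_cast hℓ.ne'
  rw [BLY, mem_closure_iff_frequently, mem_closure_iff_frequently]
  constructor
  · intro h
    have hz : (((ℓ₀ ^ 2)⁻¹ : ℝ) : ℂ) ∈ Complex.slitPlane := by
      rw [Complex.ofReal_mem_slitPlane]; positivity
    have hlog : Complex.exp (-Complex.log (((ℓ₀ ^ 2)⁻¹ : ℝ) : ℂ) / 2) = ℓ₀ := by
      rw [← Complex.ofReal_log (by positivity), Real.log_inv, Real.log_pow]
      have : (-((-((2 : ℕ) * Real.log ℓ₀) : ℝ) : ℂ) / 2) = ((Real.log ℓ₀ : ℝ) : ℂ) := by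
        push_cast; ring
      rw [this, ← Complex.ofReal_exp, Real.exp_log hℓ]
    have hc : ContinuousAt (fun z : ℂ => Complex.exp (-Complex.log z / 2))
        (((ℓ₀ ^ 2)⁻¹ : ℝ) : ℂ) :=
      (((continuousAt_clog hz).neg).div_const 2).cexp
    have hc' : Tendsto (fun z : ℂ => Complex.exp (-Complex.log z / 2))
        (𝓝 (((ℓ₀ ^ 2)⁻¹ : ℝ) : ℂ)) (𝓝 (ℓ₀ : ℂ)) := by
      have := hc.tendsto
      rwa [hlog] at this
    refine hc'.frequently (h.mono ?_)
    rintro z ⟨hz0, n, hn⟩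
    refine ⟨n, ?_⟩
    rw [← Zrooted_two_eq t _ n, hn]
    rw [← Complex.exp_nat_mul, show ((2 : ℕ) : ℂ) * (-Complex.log z / 2) = -Complex.log z by
      push_cast; ring, Complex.exp_neg, Complex.exp_log hz0]
  · intro h
    have hc' : Tendsto (fun ℓ : ℂ => (ℓ ^ 2)⁻¹) (𝓝 (ℓ₀ : ℂ))
        (𝓝 (((ℓ₀ ^ 2)⁻¹ : ℝ) : ℂ)) := by
      have := (((continuous_pow 2).tendsto (ℓ₀ : ℂ))).inv₀ (pow_ne_zero 2 hℓc)
      simpa using this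
    refine hc'.frequently ((h.and_eventually (eventually_ne_nhds hℓc)).mono ?_)
    rintro ℓ ⟨⟨n, hn⟩, hne⟩
    exact ⟨inv_ne_zero (pow_ne_zero 2 hne), n, by
      rw [Zrooted_two_eq t (inv_inv (ℓ ^ 2)) n, hn]⟩

theorem isingPair_eq_of_re_pos {t : ℝ} (ht : 1 < t) {ℓ : ℂ}
    (h : ∀ n, 0 < ((isingOrbit (t : ℂ) ℓ n) ^ 2).re) (n : ℕ) :
    (isingPair t ℓ n).2 ≠ 0 ∧
      (isingPair t ℓ n).1 = isingOrbit (t : ℂ) ℓ n * (isingPair t ℓ n).2 := by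
  induction n with
  | zero => simp [isingPair, isingOrbit]
  | succ n ih =>
    obtain ⟨h2, h1⟩ := ih
    have hden := sq_add_one_ne_zero_of_re_pos ht (h n)
    have e2 : (isingPair t ℓ (n + 1)).2 =
        (t * (isingOrbit (t : ℂ) ℓ n) ^ 2 + 1) * (isingPair t ℓ n).2 ^ 2 := by
      simp only [isingPair, h1]; ring
    refine ⟨by rw [e2]; exact mul_ne_zero hden (pow_ne_zero 2 h2), ?_⟩
    rw [e2, isingOrbit, isingMap]
    simp only [isingPair, h1]
    rw [div_mul_eq_mul_div, eq_div_iff hden]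
    ring

theorem notMem_closure_isingZeros {t ℓ₀ : ℝ} (ht : 1 < t) (hℓ : 0 < ℓ₀)
    (h13 : ℓ₀ ≠ 1 ∨ t ≤ 3) (hD : isingDisc t (ℓ₀ ^ 2) ≠ 0) :
    (ℓ₀ : ℂ) ∉ closure (isingZeros t) := by
  obtain ⟨P, hP, -, hlim, hper, hM, -⟩ := exists_limit_isingOrbit_even ht hℓ h13
  rw [mem_closure_iff_frequently, not_frequently]
  filter_upwards [eventually_forall_re_sq_isingOrbit_pos ht hℓ hP hlim hper (hM hD)]
    with ℓ h
  rintro ⟨n, hn⟩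
  obtain ⟨h2, h1⟩ := isingPair_eq_of_re_pos ht h n
  have h3 : ((isingOrbit (t : ℂ) ℓ n) ^ 2 + 1) * (isingPair t ℓ n).2 ^ 2 = 0 := by
    rw [← hn, h1]; ring
  have h4 := congrArg Complex.re ((mul_eq_zero.1 h3).resolve_right (pow_ne_zero 2 h2))
  rw [Complex.add_re, Complex.one_re, Complex.zero_re] at h4
  linarith [h n]

section Circle

variable {t : ℝ}

/-- The speed at which the unit circle parametrised by `exp (θ * I)` is traversed backwards by
`isingMap t 1`. -/
def isingCircleSpeed (t θ : ℝ) : ℝ :=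
  2 * (t ^ 2 - 1) / (t ^ 2 + 1 + 2 * t * Real.cos (2 * θ))

/-- Minus a lift of `isingMap t 1` to the universal cover of the unit circle. -/
def isingCircleLift (t θ : ℝ) : ℝ :=
  ∫ u in (0 : ℝ)..θ, isingCircleSpeed t u

/-- The lift of the marked orbit for the parameter `exp (φ * I)`. -/
def isingCircleOrbit (t φ : ℝ) : ℕ → ℝ
  | 0 => φ
  | n + 1 => φ - isingCircleLift t (isingCircleOrbit t φ n)

theorem isingCircleSpeed_denom_pos (ht : 1 < t) (θ : ℝ) :
    0 < t ^ 2 + 1 + 2 * t * Real.cos (2 * θ) := by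
  nlinarith [Real.neg_one_le_cos (2 * θ)]

theorem continuous_isingCircleSpeed (ht : 1 < t) : Continuous (isingCircleSpeed t) := by
  unfold isingCircleSpeed
  exact continuous_const.div (by fun_prop) fun θ => (isingCircleSpeed_denom_pos ht θ).ne'

theorem hasDerivAt_isingCircleLift (ht : 1 < t) (θ : ℝ) :
    HasDerivAt (isingCircleLift t) (isingCircleSpeed t θ) θ :=
  ((continuous_isingCircleSpeed ht).integral_hasStrictDerivAt 0 θ).hasDerivAt

theorem continuous_isingCircleLift (ht : 1 < t) : Continuous (isingCircleLift t) :=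
  continuous_iff_continuousAt.2 fun θ => (hasDerivAt_isingCircleLift ht θ).continuousAt

theorem isingCircleLift_zero : isingCircleLift t 0 = 0 :=
  intervalIntegral.integral_same

theorem one_le_isingCircleSpeed (ht : 3 ≤ t) (θ : ℝ) : 1 ≤ isingCircleSpeed t θ := by
  rw [isingCircleSpeed, one_le_div (isingCircleSpeed_denom_pos (by linarith) θ)]
  nlinarith [Real.cos_le_one (2 * θ)]

theorem one_lt_isingCircleSpeed (ht : 3 ≤ t) {θ : ℝ} (h : Real.cos (2 * θ) < 1) :
    1 < isingCircleSpeed t θ := by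
  rw [isingCircleSpeed, one_lt_div (isingCircleSpeed_denom_pos (by linarith) θ)]
  nlinarith

theorem hasDerivAt_isingCircleLift_sub (ht : 1 < t) (θ : ℝ) :
    HasDerivAt (fun θ => isingCircleLift t θ - θ) (isingCircleSpeed t θ - 1) θ :=
  (hasDerivAt_isingCircleLift ht θ).sub (hasDerivAt_id θ)

theorem monotone_isingCircleLift_sub (ht : 3 ≤ t) :
    Monotone fun θ => isingCircleLift t θ - θ :=
  monotone_of_hasDerivAt_nonneg (hasDerivAt_isingCircleLift_sub (by linarith)) fun θ =>
    sub_nonneg.2 (one_le_isingCircleSpeed ht θ)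

theorem le_isingCircleLift (ht : 3 ≤ t) {θ : ℝ} (hθ : 0 ≤ θ) : θ ≤ isingCircleLift t θ := by
  have := monotone_isingCircleLift_sub ht hθ
  simp only [isingCircleLift_zero] at this
  linarith

theorem isingCircleLift_le (ht : 3 ≤ t) {θ : ℝ} (hθ : θ ≤ 0) : isingCircleLift t θ ≤ θ := by
  have := monotone_isingCircleLift_sub ht hθ
  simp only [isingCircleLift_zero] at this
  linarith

theorem lt_isingCircleLift (ht : 3 ≤ t) {θ : ℝ} (h0 : 0 < θ) (h1 : θ ≤ Real.pi / 2) :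
    θ < isingCircleLift t θ := by
  have ht' : 1 < t := by linarith
  have hm : StrictMonoOn (fun θ => isingCircleLift t θ - θ) (Set.Icc 0 (Real.pi / 2)) := by
    refine strictMonoOn_of_deriv_pos (convex_Icc _ _)
      (((continuous_isingCircleLift ht').sub continuous_id).continuousOn) fun x hx => ?_
    rw [interior_Icc] at hx
    rw [(hasDerivAt_isingCircleLift_sub ht' x).deriv, sub_pos]
    refine one_lt_isingCircleSpeed ht ?_
    rw [← Real.cos_zero]
    exact Real.cos_lt_cos_of_nonneg_of_le_pi le_rfl (by linarith [hx.2]) (by linarith [hx.1])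
  have := hm ⟨le_rfl, by positivity⟩ ⟨h0.le, h1⟩ h0
  simp only [isingCircleLift_zero] at this
  linarith

theorem ofReal_mul_add_one_ne_zero (ht : 1 < t) {w : ℂ} (hw : ‖w‖ = 1) :
    (t : ℂ) * w + 1 ≠ 0 := by
  intro h
  have h1 : ‖(t : ℂ) * w‖ = ‖(1 : ℂ)‖ := by rw [eq_neg_of_add_eq_zero_left h, norm_neg]
  rw [norm_mul, hw, Complex.norm_real, Real.norm_eq_abs, abs_of_pos (by linarith), norm_one] at h1
  linarith

theorem add_ofReal_ne_zero (ht : 1 < t) {w : ℂ} (hw : ‖w‖ = 1) : w + (t : ℂ) ≠ 0 := by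
  intro h
  have h1 : ‖w‖ = ‖(t : ℂ)‖ := by rw [eq_neg_of_add_eq_zero_left h, norm_neg]
  rw [hw, Complex.norm_real, Real.norm_eq_abs, abs_of_pos (by linarith)] at h1
  linarith

theorem exp_isingCircleLift (ht : 1 < t) (θ : ℝ) :
    Complex.exp (isingCircleLift t θ * Complex.I) *
      (Complex.exp (θ * Complex.I) ^ 2 + t) = t * Complex.exp (θ * Complex.I) ^ 2 + 1 := by
  have hn : ∀ x : ℝ, ‖Complex.exp (x * Complex.I) ^ 2‖ = 1 := fun x => by
    rw [norm_pow, Complex.norm_exp_ofReal_mul_I, one_pow]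
  have hd1 := fun x => ofReal_mul_add_one_ne_zero ht (hn x)
  have hd2 := fun x => add_ofReal_ne_zero ht (hn x)
  have hderiv : ∀ x : ℝ, HasDerivAt (fun x : ℝ => Complex.exp (isingCircleLift t x * Complex.I) *
      (Complex.exp (x * Complex.I) ^ 2 + t) / (t * Complex.exp (x * Complex.I) ^ 2 + 1)) 0 x := by
    intro x
    have e1 : HasDerivAt (fun x : ℝ => Complex.exp (x * Complex.I))
        (Complex.exp (x * Complex.I) * (1 * Complex.I)) x :=
      ((HasDerivAt.ofReal_comp (hasDerivAt_id x)).mul_const Complex.I).cexp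
    have e2 : HasDerivAt (fun x : ℝ => Complex.exp (isingCircleLift t x * Complex.I))
        (Complex.exp (isingCircleLift t x * Complex.I) * (isingCircleSpeed t x * Complex.I)) x :=
      ((HasDerivAt.ofReal_comp (hasDerivAt_isingCircleLift ht x)).mul_const Complex.I).cexp
    have e3 := (e2.mul ((e1.pow 2).add_const (t : ℂ))).div
      (((e1.pow 2).const_mul (t : ℂ)).add_const 1) (hd1 x)
    have hρ : (isingCircleSpeed t x : ℂ) * ((Complex.exp (x * Complex.I) ^ 2 + t) *
        (t * Complex.exp (x * Complex.I) ^ 2 + 1)) =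
        2 * (t ^ 2 - 1) * Complex.exp (x * Complex.I) ^ 2 := by
      have hden : ((t ^ 2 + 1 + 2 * t * Real.cos (2 * x) : ℝ) : ℂ) ≠ 0 := by
        exact_mod_cast (isingCircleSpeed_denom_pos ht x).ne'
      have hcos : 2 * (Real.cos (2 * x) : ℂ) * Complex.exp (x * Complex.I) ^ 2 =
          (Complex.exp (x * Complex.I) ^ 2) ^ 2 + 1 := by
        rw [Complex.ofReal_cos, Complex.two_cos, add_mul, ← Complex.exp_nat_mul,
          ← Complex.exp_nat_mul, ← Complex.exp_add, ← Complex.exp_add]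
        congr 1
        · congr 1; push_cast; ring
        · rw [← Complex.exp_zero]; congr 1; push_cast; ring
      have hs : (isingCircleSpeed t x : ℂ) * ((t ^ 2 + 1 + 2 * t * Real.cos (2 * x) : ℝ) : ℂ) =
          2 * (t ^ 2 - 1) := by
        rw [← Complex.ofReal_mul, isingCircleSpeed,
          div_mul_cancel₀ _ (isingCircleSpeed_denom_pos ht x).ne']
        push_cast; ring
      rw [← hs]
      push_cast at hcos ⊢
      linear_combination (-(isingCircleSpeed t x : ℂ) * t) * hcos
    refine e3.congr_deriv ?_
    rw [div_eq_zero_iff]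
    left
    simp only [Nat.cast_ofNat, Pi.mul_apply, Pi.pow_apply]
    linear_combination (Complex.exp (isingCircleLift t x * Complex.I) * Complex.I) * hρ
  have hconst := is_const_of_deriv_eq_zero (fun x => (hderiv x).differentiableAt)
    (fun x => (hderiv x).deriv) θ 0
  have h1t : (t : ℂ) + 1 ≠ 0 := by simpa using hd1 0
  simp only [isingCircleLift_zero, Complex.ofReal_zero, zero_mul, Complex.exp_zero, one_pow,
    one_mul, mul_one] at hconst
  rw [add_comm (1 : ℂ), div_self h1t, div_eq_one_iff_eq (hd1 θ)] at hconst
  exact hconst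

theorem isingPair_exp (ht : 1 < t) (φ : ℝ) (n : ℕ) :
    (isingPair t (Complex.exp (φ * Complex.I)) n).2 ≠ 0 ∧
      (isingPair t (Complex.exp (φ * Complex.I)) n).1 =
        Complex.exp (isingCircleOrbit t φ n * Complex.I) *
          (isingPair t (Complex.exp (φ * Complex.I)) n).2 := by
  induction n with
  | zero => simp [isingPair, isingCircleOrbit]
  | succ n ih =>
    obtain ⟨h2, h1⟩ := ih
    set θ := isingCircleOrbit t φ n with hθ
    have e2 : (isingPair t (Complex.exp (φ * Complex.I)) (n + 1)).2 =
        (t * Complex.exp (θ * Complex.I) ^ 2 + 1) *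
          (isingPair t (Complex.exp (φ * Complex.I)) n).2 ^ 2 := by
      simp only [isingPair, h1]; ring
    refine ⟨?_, ?_⟩
    · rw [e2]
      refine mul_ne_zero (ofReal_mul_add_one_ne_zero ht ?_) (pow_ne_zero 2 h2)
      rw [norm_pow, Complex.norm_exp_ofReal_mul_I, one_pow]
    · rw [e2, ← exp_isingCircleLift ht, isingCircleOrbit, ← hθ]
      have : Complex.exp (φ * Complex.I) =
          Complex.exp ((φ - isingCircleLift t θ : ℝ) * Complex.I) *
            Complex.exp (isingCircleLift t θ * Complex.I) := by
        rw [← Complex.exp_add]; congr 1; push_cast; ring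
      simp only [isingPair, h1]
      linear_combination (Complex.exp (θ * Complex.I) ^ 2 + t) *
        (isingPair t (Complex.exp (φ * Complex.I)) n).2 ^ 2 * this

theorem exp_mem_isingZeros (ht : 1 < t) {φ : ℝ} {n : ℕ}
    (h : isingCircleOrbit t φ n = Real.pi / 2) :
    Complex.exp (φ * Complex.I) ∈ isingZeros t := by
  refine ⟨n, ?_⟩
  rw [(isingPair_exp ht φ n).2, h]
  push_cast
  rw [Complex.exp_pi_div_two_mul_I, mul_pow, Complex.I_sq]
  ring

theorem isingCircleOrbit_zero (n : ℕ) : isingCircleOrbit t 0 n = 0 := by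
  induction n with
  | zero => rfl
  | succ n ih => rw [isingCircleOrbit, ih, isingCircleLift_zero, sub_zero]

theorem continuous_isingCircleOrbit (ht : 1 < t) (n : ℕ) :
    Continuous fun φ => isingCircleOrbit t φ n := by
  induction n with
  | zero => exact continuous_id
  | succ n ih => exact continuous_id.sub ((continuous_isingCircleLift ht).comp ih)

theorem exists_lt_isingCircleOrbit (ht : 3 ≤ t) {φ : ℝ} (hφ : 0 < φ) :
    ∃ n, Real.pi / 2 < isingCircleOrbit t φ n := by
  by_contra! hle
  have step : ∀ k, φ ≤ isingCircleOrbit t φ (2 * k) →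
      isingCircleLift t (isingCircleOrbit t φ (2 * k)) ≤ isingCircleOrbit t φ (2 * (k + 1)) := by
    intro k hk
    have h1 := le_isingCircleLift ht (hφ.le.trans hk)
    have h2 := isingCircleLift_le ht
      (θ := φ - isingCircleLift t (isingCircleOrbit t φ (2 * k))) (by linarith)
    rw [show 2 * (k + 1) = 2 * k + 1 + 1 by ring]
    simp only [isingCircleOrbit]
    linarith
  have hge : ∀ k, φ ≤ isingCircleOrbit t φ (2 * k) := fun k => by
    induction k with
    | zero => exact le_rfl
    | succ k ih => exact ih.trans ((le_isingCircleLift ht (hφ.le.trans ih)).trans (step k ih))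
  have hmono : Monotone fun k => isingCircleOrbit t φ (2 * k) := monotone_nat_of_le_succ fun k =>
    (le_isingCircleLift ht (hφ.le.trans (hge k))).trans (step k (hge k))
  have hlim := tendsto_atTop_ciSup hmono ⟨Real.pi / 2, by rintro _ ⟨k, rfl⟩; exact hle _⟩
  set L := ⨆ k, isingCircleOrbit t φ (2 * k)
  have hL0 : φ ≤ L := ge_of_tendsto' hlim hge
  have hL1 : L ≤ Real.pi / 2 := le_of_tendsto' hlim fun k => hle _
  have hL2 : isingCircleLift t L ≤ L :=
    le_of_tendsto_of_tendsto' (((continuous_isingCircleLift (by linarith)).tendsto L).comp hlim)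
      (hlim.comp (tendsto_add_atTop_nat 1)) fun k => step k (hge k)
  exact (lt_isingCircleLift ht (hφ.trans_le hL0) hL1).not_ge hL2

theorem one_mem_closure_isingZeros (ht : 3 ≤ t) : (1 : ℂ) ∈ closure (isingZeros t) := by
  have ht' : 1 < t := by linarith
  rw [Metric.mem_closure_iff]
  intro ε hε
  have hc : Continuous fun φ : ℝ => Complex.exp (φ * Complex.I) := by fun_prop
  obtain ⟨δ, hδ, hball⟩ := Metric.continuous_iff.1 hc 0 ε hε
  obtain ⟨n, hn⟩ := exists_lt_isingCircleOrbit ht (half_pos hδ)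
  obtain ⟨φ, ⟨h0, h1⟩, h2⟩ := intermediate_value_Icc (half_pos hδ).le
    (continuous_isingCircleOrbit ht' n).continuousOn
    (show Real.pi / 2 ∈ Set.Icc _ _ from ⟨by rw [isingCircleOrbit_zero]; positivity, hn.le⟩)
  refine ⟨_, exp_mem_isingZeros ht' h2, ?_⟩
  rw [dist_comm]
  simpa using hball φ (by rw [Real.dist_eq, sub_zero, abs_of_nonneg h0]; linarith)

end Circle

section Critical

theorem add_I_ne_zero_of_re_pos {z : ℂ} (hz : 0 < z.re) : z + Complex.I ≠ 0 := by
  intro h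
  have := congrArg Complex.re h
  simp only [Complex.add_re, Complex.I_re, add_zero, Complex.zero_re] at this
  exact hz.ne' this

/-- The Cayley transform of the upper half plane, shifted to send the real axis to the circle. -/
def cayleyMap (z : ℂ) : ℂ := (z - Complex.I) / (z + Complex.I)

theorem one_le_norm_ofReal_add_I (x : ℝ) : 1 ≤ ‖(x : ℂ) + Complex.I‖ := by
  simpa using Complex.abs_im_le_norm ((x : ℂ) + Complex.I)

theorem ofReal_add_I_ne_zero (x : ℝ) : (x : ℂ) + Complex.I ≠ 0 :=
  norm_pos_iff.1 (one_pos.trans_le (one_le_norm_ofReal_add_I x))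

theorem norm_cayleyMap_ofReal (x : ℝ) : ‖cayleyMap x‖ = 1 := by
  have : (x : ℂ) - Complex.I = (starRingEnd ℂ) (x + Complex.I) := by
    simp [sub_eq_add_neg]
  rw [cayleyMap, this, norm_div, Complex.norm_conj,
    div_self (norm_ne_zero_iff.2 (ofReal_add_I_ne_zero x))]

theorem norm_cayleyMap_sub (x y : ℝ) : ‖cayleyMap x - cayleyMap y‖ *
    (‖(x : ℂ) + Complex.I‖ * ‖(y : ℂ) + Complex.I‖) = 2 * |x - y| := by
  have : (cayleyMap x - cayleyMap y) * ((x + Complex.I) * (y + Complex.I)) =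
      2 * Complex.I * ((x - y : ℝ) : ℂ) := by
    rw [cayleyMap, cayleyMap, div_sub_div _ _ (ofReal_add_I_ne_zero x) (ofReal_add_I_ne_zero y),
      div_mul_cancel₀ _ (mul_ne_zero (ofReal_add_I_ne_zero x) (ofReal_add_I_ne_zero y))]
    push_cast
    ring
  have := congrArg norm this
  simpa [-Complex.ofReal_sub] using this

theorem norm_cayleyMap_sub_le (x y : ℝ) : ‖cayleyMap x - cayleyMap y‖ ≤ 2 * |x - y| := by
  rw [← norm_cayleyMap_sub]
  exact le_mul_of_one_le_right (norm_nonneg _)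
    (one_le_mul_of_one_le_of_one_le (one_le_norm_ofReal_add_I x) (one_le_norm_ofReal_add_I y))

theorem abs_sub_le_norm_cayleyMap_sub {x y B : ℝ} (hx : |x| ≤ B) (hy : |y| ≤ B) :
    |x - y| ≤ ‖cayleyMap x - cayleyMap y‖ * (B + 1) ^ 2 := by
  have hn : ∀ z : ℝ, |z| ≤ B → ‖(z : ℂ) + Complex.I‖ ≤ B + 1 := fun z hz =>
    (norm_add_le _ _).trans (by simpa using hz)
  have h1 := mul_le_mul (hn x hx) (hn y hy) (norm_nonneg _)
    ((norm_nonneg _).trans (hn x hx))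
  have h2 := mul_le_mul_of_nonneg_left h1 (norm_nonneg (cayleyMap x - cayleyMap y))
  rw [norm_cayleyMap_sub] at h2
  nlinarith [abs_nonneg (x - y)]

/-- The product of the Cayley transforms of `isingOrbit` and of `ℓ`: wherever `ℓ` is not a zero it
omits `0`, and it equals `1` only if the orbit hits `-ℓ`. -/
def isingPhase (t : ℝ) (n : ℕ) (ℓ : ℂ) : ℂ :=
  (((isingPair t ℓ n).1 - Complex.I * (isingPair t ℓ n).2) * (ℓ - Complex.I)) /
    (((isingPair t ℓ n).1 + Complex.I * (isingPair t ℓ n).2) * (ℓ + Complex.I))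

variable {t ℓ₀ : ℝ}

theorem differentiable_isingPair (t : ℂ) (n : ℕ) :
    Differentiable ℂ (fun ℓ => (isingPair t ℓ n).1) ∧
      Differentiable ℂ (fun ℓ => (isingPair t ℓ n).2) := by
  induction n with
  | zero => exact ⟨differentiable_id, differentiable_const _⟩
  | succ n ih =>
    obtain ⟨h1, h2⟩ := ih
    exact ⟨differentiable_id.mul ((h1.pow 2).add ((differentiable_const t).mul (h2.pow 2))),
      ((differentiable_const t).mul (h1.pow 2)).add (h2.pow 2)⟩

theorem isingPair_factors_ne_zero {ℓ : ℂ} (h : ℓ ∉ isingZeros t) (n : ℕ) :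
    (isingPair t ℓ n).1 - Complex.I * (isingPair t ℓ n).2 ≠ 0 ∧
      (isingPair t ℓ n).1 + Complex.I * (isingPair t ℓ n).2 ≠ 0 := by
  rw [← mul_ne_zero_iff]
  intro h0
  refine h ⟨n, ?_⟩
  rw [← h0]
  linear_combination (isingPair t ℓ n).2 ^ 2 * Complex.I_sq

theorem isingPhase_denom_ne_zero {ℓ : ℂ} (h : ℓ ∉ isingZeros t) (hre : 0 < ℓ.re) (n : ℕ) :
    ((isingPair t ℓ n).1 + Complex.I * (isingPair t ℓ n).2) * (ℓ + Complex.I) ≠ 0 :=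
  mul_ne_zero (isingPair_factors_ne_zero h n).2 (add_I_ne_zero_of_re_pos hre)

theorem isingPhase_ne_zero {ℓ : ℂ} (h : ℓ ∉ isingZeros t) (hre : 0 < ℓ.re) (n : ℕ) :
    isingPhase t n ℓ ≠ 0 := by
  refine div_ne_zero (mul_ne_zero (isingPair_factors_ne_zero h n).1 ?_)
    (isingPhase_denom_ne_zero h hre n)
  intro h0
  rw [sub_eq_zero.1 h0, Complex.I_re] at hre
  exact hre.false

theorem isingPhase_succ_ne_one (ht : 1 < t) {ℓ : ℂ} (h : ℓ ∉ isingZeros t) (hre : 0 < ℓ.re)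
    (n : ℕ) : isingPhase t (n + 1) ℓ ≠ 1 := by
  rw [isingPhase, ne_eq, div_eq_one_iff_eq (isingPhase_denom_ne_zero h hre _)]
  intro h0
  have h1 : (2 * Complex.I * ℓ * (1 + t)) *
      ((isingPair t ℓ n).1 ^ 2 + (isingPair t ℓ n).2 ^ 2) = 0 := by
    simp only [isingPair] at h0
    linear_combination -h0
  have hℓ : ℓ ≠ 0 := by rintro rfl; simp at hre
  have ht1 : (1 : ℂ) + t ≠ 0 := by
    have : (1 : ℝ) + t ≠ 0 := by linarith
    exact_mod_cast this
  refine h ⟨n, (mul_eq_zero.1 h1).resolve_left ?_⟩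
  exact mul_ne_zero (mul_ne_zero (mul_ne_zero two_ne_zero Complex.I_ne_zero) hℓ) ht1

theorem isingPhase_ofReal (ht : 1 < t) (hℓ : 0 < ℓ₀) (n : ℕ) :
    isingPhase t n ℓ₀ = cayleyMap (isingOrbit t ℓ₀ n : ℝ) * cayleyMap ℓ₀ := by
  obtain ⟨h2, h1⟩ := isingPair_eq_of_re_pos (ℓ := (ℓ₀ : ℂ)) ht
    (fun n => by rw [← ofReal_isingOrbit]; exact ofReal_re_sq_pos (isingOrbit_pos ht hℓ n)) n
  rw [← ofReal_isingOrbit] at h1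
  rw [isingPhase, h1, ← sub_mul, ← add_mul, cayleyMap, cayleyMap, div_mul_div_comm,
    mul_right_comm, mul_right_comm _ (isingPair t ℓ₀ n).2, mul_div_mul_right _ _ h2]

theorem norm_isingPhase_sub_le (ht : 1 < t) {R : ℝ} (hR : 0 < R) (hRℓ : 2 * R ≤ ℓ₀)
    (hZ : ∀ ℓ ∈ Metric.ball (ℓ₀ : ℂ) (2 * R), ℓ ∉ isingZeros t) {ℓ : ℝ} (hℓ : |ℓ - ℓ₀| < R)
    (n : ℕ) : ‖isingPhase t (n + 1) ℓ - isingPhase t (n + 1) ℓ₀‖ ≤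
      1536 * Real.pi / R * |ℓ - ℓ₀| := by
  have hre : ∀ z ∈ Metric.ball (ℓ₀ : ℂ) (2 * R), 0 < z.re := fun z hz => by
    rw [Metric.mem_ball, Complex.dist_eq] at hz
    have h1 := (Complex.abs_re_le_norm _).trans_lt hz
    rw [Complex.sub_re, Complex.ofReal_re, abs_lt] at h1
    linarith [h1.1]
  have hdiff : DifferentiableOn ℂ (isingPhase t (n + 1)) (Metric.ball (ℓ₀ : ℂ) (2 * R)) := by
    obtain ⟨h1, h2⟩ := differentiable_isingPair t (n + 1)
    refine DifferentiableOn.div ?_ ?_ fun z hz => isingPhase_denom_ne_zero (hZ z hz) (hre z hz) _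
    · exact ((h1.sub ((differentiable_const _).mul h2)).mul
        (differentiable_id.sub (differentiable_const _))).differentiableOn
    · exact ((h1.add ((differentiable_const _).mul h2)).mul
        (differentiable_id.add (differentiable_const _))).differentiableOn
  have hsub : ∀ x : ℝ, |x - ℓ₀| < R →
      Metric.ball (x : ℂ) R ⊆ Metric.ball (ℓ₀ : ℂ) (2 * R) := fun x hx => by
    refine Metric.ball_subset_ball' ?_
    rw [Complex.dist_eq, ← Complex.ofReal_sub, Complex.norm_real, Real.norm_eq_abs]
    linarith
  have hbound : ∀ x : ℝ, |x - ℓ₀| < R →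
      ‖deriv (isingPhase t (n + 1)) x‖ ≤ 1536 * Real.pi / R := fun x hx => by
    refine norm_deriv_le_of_omits_zero_one hR (hdiff.mono (hsub x hx))
      (fun z hz => isingPhase_ne_zero (hZ z (hsub x hx hz)) (hre z (hsub x hx hz)) _)
      (fun z hz => isingPhase_succ_ne_one ht (hZ z (hsub x hx hz)) (hre z (hsub x hx hz)) _) ?_
    have hx0 : 0 < x := by linarith [(abs_lt.1 hx).1]
    rw [isingPhase_ofReal ht hx0, norm_mul, norm_cayleyMap_ofReal, norm_cayleyMap_ofReal, one_mul]
  have hmem : ∀ x ∈ Metric.ball ℓ₀ R, |x - ℓ₀| < R := fun x hx => by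
    rwa [Metric.mem_ball, Real.dist_eq] at hx
  have := Convex.norm_image_sub_le_of_norm_hasDerivWithin_le (𝕜 := ℝ)
    (f := fun x : ℝ => isingPhase t (n + 1) x) (f' := fun x => deriv (isingPhase t (n + 1)) x)
    (s := Metric.ball ℓ₀ R) (C := 1536 * Real.pi / R) (x := ℓ₀) (y := ℓ)
    (fun x hx => (((hdiff x (hsub x (hmem x hx) (Metric.mem_ball_self hR))).differentiableAt
      (Metric.isOpen_ball.mem_nhds (hsub x (hmem x hx)
        (Metric.mem_ball_self hR)))).hasDerivAt.comp_ofReal).hasDerivWithinAt)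
    (fun x hx => hbound x (hmem x hx)) (convex_ball _ _) (Metric.mem_ball_self hR)
    (by rwa [Metric.mem_ball, Real.dist_eq])
  simpa using this

theorem tendsto_isingPhase (ht : 1 < t) (hℓ : 0 < ℓ₀) {P : ℝ}
    (hlim : Tendsto (fun n => isingOrbit t ℓ₀ (2 * n)) atTop (𝓝 P)) :
    Tendsto (fun n => isingPhase t (2 * n + 1 + 1) ℓ₀) atTop
      (𝓝 (cayleyMap P * cayleyMap ℓ₀)) := by
  simp only [isingPhase_ofReal ht hℓ]
  refine Tendsto.mul_const _ ?_
  have hc : ContinuousAt cayleyMap P := by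
    unfold cayleyMap
    exact ContinuousAt.div (by fun_prop) (by fun_prop) (ofReal_add_I_ne_zero P)
  have h1 : Tendsto (fun n => ((isingOrbit t ℓ₀ (2 * n + 1 + 1) : ℝ) : ℂ)) atTop (𝓝 (P : ℂ)) :=
    (Complex.continuous_ofReal.tendsto P).comp (hlim.comp (tendsto_add_atTop_nat 1))
  exact hc.tendsto.comp h1

theorem abs_limit_sub_le (ht : 1 < t) {R : ℝ} (hR : 0 < R) (hRℓ : 2 * R ≤ ℓ₀)
    (hZ : ∀ ℓ ∈ Metric.ball (ℓ₀ : ℂ) (2 * R), ℓ ∉ isingZeros t) {ℓ : ℝ} (hℓ : |ℓ - ℓ₀| < R)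
    {P₀ P B : ℝ} (h₀ : Tendsto (fun n => isingOrbit t ℓ₀ (2 * n)) atTop (𝓝 P₀))
    (h : Tendsto (fun n => isingOrbit t ℓ (2 * n)) atTop (𝓝 P)) (hB₀ : |P₀| ≤ B) (hB : |P| ≤ B) :
    |P - P₀| ≤ (1536 * Real.pi / R + 2) * (B + 1) ^ 2 * |ℓ - ℓ₀| := by
  have hℓ0 : 0 < ℓ := by linarith [(abs_lt.1 hℓ).1]
  have h1 : ‖cayleyMap P * cayleyMap ℓ - cayleyMap P₀ * cayleyMap ℓ₀‖ ≤
      1536 * Real.pi / R * |ℓ - ℓ₀| :=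
    le_of_tendsto' ((tendsto_isingPhase ht hℓ0 h).sub
      (tendsto_isingPhase ht (by linarith) h₀)).norm
      fun n => norm_isingPhase_sub_le ht hR hRℓ hZ hℓ _
  have h2 : ‖cayleyMap P - cayleyMap P₀‖ ≤ 1536 * Real.pi / R * |ℓ - ℓ₀| + 2 * |ℓ - ℓ₀| :=
    calc ‖cayleyMap P - cayleyMap P₀‖ = ‖(cayleyMap P - cayleyMap P₀) * cayleyMap ℓ‖ := by
          rw [norm_mul, norm_cayleyMap_ofReal, mul_one]
      _ = ‖(cayleyMap P * cayleyMap ℓ - cayleyMap P₀ * cayleyMap ℓ₀) -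
          cayleyMap P₀ * (cayleyMap ℓ - cayleyMap ℓ₀)‖ := by congr 1; ring
      _ ≤ _ := norm_sub_le _ _
      _ ≤ _ := by
        refine add_le_add h1 ?_
        rw [norm_mul, norm_cayleyMap_ofReal, one_mul]
        exact norm_cayleyMap_sub_le _ _
  calc |P - P₀| ≤ ‖cayleyMap P - cayleyMap P₀‖ * (B + 1) ^ 2 :=
        abs_sub_le_norm_cayleyMap_sub hB hB₀
    _ ≤ (1536 * Real.pi / R * |ℓ - ℓ₀| + 2 * |ℓ - ℓ₀|) * (B + 1) ^ 2 := by gcongr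
    _ = _ := by ring

theorem exists_isingDisc_neg (ht : 1 < t) (hℓ : 0 < ℓ₀) (h1 : ℓ₀ ≠ 1)
    (hD : isingDisc t (ℓ₀ ^ 2) = 0) {ε : ℝ} (hε : 0 < ε) :
    ∃ ℓ, |ℓ - ℓ₀| < ε ∧ 0 < |ℓ - ℓ₀| ∧ ℓ ≠ 1 ∧ isingDisc t (ℓ ^ 2) < 0 := by
  have key : ∀ ℓ : ℝ, isingDisc t (ℓ ^ 2) * ℓ₀ ^ 2 =
      4 * t * ((ℓ ^ 2 - ℓ₀ ^ 2) * ((ℓ * ℓ₀) ^ 2 - 1)) := fun ℓ => by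
    simp only [isingDisc] at hD ⊢
    linear_combination ℓ ^ 2 * hD
  have neg : ∀ ℓ : ℝ, (ℓ ^ 2 - ℓ₀ ^ 2) * ((ℓ * ℓ₀) ^ 2 - 1) < 0 → isingDisc t (ℓ ^ 2) < 0 :=
    fun ℓ h => by
      have h2 : isingDisc t (ℓ ^ 2) * ℓ₀ ^ 2 < 0 := by
        rw [key]; exact mul_neg_of_pos_of_neg (by linarith) h
      exact neg_of_mul_neg_left h2 (by positivity)
  rcases h1.lt_or_gt with h | h
  · obtain ⟨ℓ, ha, hb⟩ := exists_between (lt_min h (lt_add_of_pos_right ℓ₀ hε))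
    obtain ⟨hb1, hb2⟩ := lt_min_iff.1 hb
    refine ⟨ℓ, ?_, abs_pos.2 (by linarith), hb1.ne, neg ℓ (mul_neg_of_pos_of_neg ?_ ?_)⟩
    · rw [abs_of_pos (by linarith)]; linarith
    · nlinarith
    · have : ℓ * ℓ₀ < 1 := by nlinarith
      have : 0 < ℓ * ℓ₀ := mul_pos (by linarith) hℓ
      nlinarith
  · obtain ⟨ℓ, ha, hb⟩ := exists_between (max_lt h (sub_lt_self ℓ₀ hε))
    obtain ⟨ha1, ha2⟩ := max_lt_iff.1 ha
    refine ⟨ℓ, ?_, abs_pos.2 (by linarith), ha1.ne', neg ℓ (mul_neg_of_neg_of_pos ?_ ?_)⟩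
    · rw [abs_of_neg (by linarith)]; linarith
    · nlinarith
    · have : 1 < ℓ * ℓ₀ := by nlinarith
      nlinarith

theorem abs_transversality_le {c ℓ P x B K : ℝ} (ht : 1 < t) (hc : 0 < c) (hP : 0 < P)
    (hPB : P ≤ B) (hx : 0 < x) (hxB : x ≤ B) (hp1 : (t + c ^ 2) * (2 * P) = c * (t ^ 2 - 1))
    (hp2 : (t + c ^ 2) * P ^ 2 = 1 + c ^ 2 * t)
    (hxq : (t + ℓ ^ 2) * x ^ 2 - ℓ * (t ^ 2 - 1) * x + 1 + ℓ ^ 2 * t = 0)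
    (hy : |x - P| ≤ K * |ℓ - c|) (hne : 0 < |ℓ - c|) :
    |2 * c * P ^ 2 - (t ^ 2 - 1) * P + 2 * c * t| ≤
      ((t + c ^ 2) * K ^ 2 + (B ^ 2 + t) + K * (4 * c * B + (t ^ 2 - 1))) * |ℓ - c| := by
  have hid : (t + c ^ 2) * (x - P) ^ 2 + (ℓ - c) * (2 * c * x ^ 2 - (t ^ 2 - 1) * x +
      2 * c * t) + (ℓ - c) ^ 2 * (x ^ 2 + t) = 0 := by
    linear_combination hxq - x * hp1 + hp2
  have hh : |ℓ - c| ^ 2 = (ℓ - c) ^ 2 := sq_abs _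
  have e0 : |(ℓ - c) * (2 * c * x ^ 2 - (t ^ 2 - 1) * x + 2 * c * t)| =
      |ℓ - c| * |2 * c * x ^ 2 - (t ^ 2 - 1) * x + 2 * c * t| := abs_mul _ _
  have hKh : 0 ≤ K * |ℓ - c| := (abs_nonneg _).trans hy
  generalize |ℓ - c| = h at *
  have hsq : (x - P) ^ 2 ≤ (K * h) ^ 2 := by
    rw [← sq_abs (x - P)]
    exact pow_le_pow_left₀ (abs_nonneg _) hy 2
  have hgx : |2 * c * x ^ 2 - (t ^ 2 - 1) * x + 2 * c * t| ≤
      ((t + c ^ 2) * K ^ 2 + (B ^ 2 + t)) * h := by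
    refine le_of_mul_le_mul_left ?_ hne
    have e1 : (ℓ - c) * (2 * c * x ^ 2 - (t ^ 2 - 1) * x + 2 * c * t) =
        -((t + c ^ 2) * (x - P) ^ 2 + h ^ 2 * (x ^ 2 + t)) := by
      rw [hh]; linear_combination hid
    rw [← e0, e1, abs_neg, abs_of_nonneg (by positivity)]
    calc (t + c ^ 2) * (x - P) ^ 2 + h ^ 2 * (x ^ 2 + t)
        ≤ (t + c ^ 2) * (K * h) ^ 2 + h ^ 2 * (B ^ 2 + t) :=
          add_le_add (mul_le_mul_of_nonneg_left hsq (by positivity))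
            (mul_le_mul_of_nonneg_left
              (by linarith [pow_le_pow_left₀ hx.le hxB 2]) (sq_nonneg h))
      _ = _ := by ring
  have hgd : |(x - P) * (2 * c * (x + P) - (t ^ 2 - 1))| ≤
      K * h * (4 * c * B + (t ^ 2 - 1)) := by
    rw [abs_mul]
    refine mul_le_mul hy ?_ (abs_nonneg _) hKh
    have h1 : 2 * c * (x + P) ≤ 2 * c * (B + B) :=
      mul_le_mul_of_nonneg_left (add_le_add hxB hPB) (by positivity)
    have h2 : 0 < 2 * c * (x + P) := by positivity
    have h3 : 0 < t ^ 2 - 1 := by nlinarith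
    rw [abs_le]
    constructor <;> linarith
  calc |2 * c * P ^ 2 - (t ^ 2 - 1) * P + 2 * c * t|
      = |(2 * c * x ^ 2 - (t ^ 2 - 1) * x + 2 * c * t) -
        (x - P) * (2 * c * (x + P) - (t ^ 2 - 1))| := by congr 1; ring
    _ ≤ _ := abs_sub _ _
    _ ≤ _ := add_le_add hgx hgd
    _ = _ := by ring

theorem eq_zero_of_forall_abs_le {G M R : ℝ} {S : Set ℝ} (hR : 0 < R) (hM : 0 < M)
    (hS : ∀ ε > 0, ∃ ℓ ∈ S, |ℓ| < ε) (h : ∀ ℓ ∈ S, |ℓ| < R → |G| ≤ M * |ℓ|) : G = 0 := by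
  by_contra hG
  have hG' := abs_pos.2 hG
  obtain ⟨ℓ, hℓ, hlt⟩ := hS (min R (|G| / M)) (lt_min hR (div_pos hG' hM))
  have h3 := h ℓ hℓ (hlt.trans_le (min_le_left _ _))
  have h4 := hlt.trans_le (min_le_right _ _)
  rw [lt_div_iff₀ hM] at h4
  linarith

theorem mem_closure_isingZeros_of_isingDisc_eq_zero (ht : 1 < t) (hℓ : 0 < ℓ₀) (h1 : ℓ₀ ≠ 1)
    (hD : isingDisc t (ℓ₀ ^ 2) = 0) : (ℓ₀ : ℂ) ∈ closure (isingZeros t) := by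
  by_contra hcl
  rw [mem_closure_iff_frequently, not_frequently] at hcl
  obtain ⟨δ, hδ, hball⟩ := Metric.eventually_nhds_iff_ball.1 hcl
  obtain ⟨R, hR, hRδ⟩ := exists_between (half_pos (lt_min hδ hℓ))
  have hRδ' : 2 * R ≤ δ := by linarith [min_le_left δ ℓ₀]
  have hRℓ : 2 * R ≤ ℓ₀ := by linarith [min_le_right δ ℓ₀]
  have hZ : ∀ ℓ ∈ Metric.ball (ℓ₀ : ℂ) (2 * R), ℓ ∉ isingZeros t := fun ℓ h =>
    hball ℓ (Metric.ball_subset_ball hRδ' h)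
  obtain ⟨P, hP, hPle, hlim, -, -, -, hPD⟩ := exists_limit_isingOrbit_even ht hℓ (Or.inl h1)
  have hp1 := hPD hD
  have hp2 : (t + ℓ₀ ^ 2) * P ^ 2 = 1 + ℓ₀ ^ 2 * t := by
    have hpos : 4 * (t + ℓ₀ ^ 2) ≠ 0 := by positivity
    refine mul_left_cancel₀ hpos ?_
    simp only [isingDisc] at hD
    linear_combination ((t + ℓ₀ ^ 2) * (2 * P) + ℓ₀ * (t ^ 2 - 1)) * hp1 - hD
  have hPB : P ≤ 2 * ℓ₀ * t := by nlinarith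
  have hg : 2 * ℓ₀ * P ^ 2 - (t ^ 2 - 1) * P + 2 * ℓ₀ * t = 0 := by
    have ht1 : 0 < t ^ 2 - 1 := by nlinarith
    obtain ⟨K, hK0, hK⟩ : ∃ K, 0 ≤ K ∧
        K = (1536 * Real.pi / R + 2) * (2 * ℓ₀ * t + 1) ^ 2 := ⟨_, by positivity, rfl⟩
    refine eq_zero_of_forall_abs_le (S := {h | 0 < |h| ∧ ℓ₀ + h ≠ 1 ∧
      isingDisc t ((ℓ₀ + h) ^ 2) < 0}) (M := (t + ℓ₀ ^ 2) * K ^ 2 + ((2 * ℓ₀ * t) ^ 2 + t) +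
      K * (4 * ℓ₀ * (2 * ℓ₀ * t) + (t ^ 2 - 1))) hR (by positivity) ?_
      fun h ⟨hne, hℓ1, hneg⟩ hhR => ?_
    · intro ε hε
      obtain ⟨ℓ, ha, hb, hc, hd⟩ := exists_isingDisc_neg ht hℓ h1 hD hε
      exact ⟨ℓ - ℓ₀, ⟨hb, by rwa [add_sub_cancel], by rwa [add_sub_cancel]⟩, ha⟩
    · have hh : |ℓ₀ + h - ℓ₀| = |h| := by rw [add_sub_cancel_left]
      have hhR' := abs_lt.1 hhR
      have hℓ0 : 0 < ℓ₀ + h := by linarith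
      obtain ⟨x, hx, hxle, hxlim, -, -, hxq, -⟩ :=
        exists_limit_isingOrbit_even ht hℓ0 (Or.inl hℓ1)
      have hxB : x ≤ 2 * ℓ₀ * t :=
        hxle.trans (mul_le_mul_of_nonneg_right (by linarith) (by linarith))
      have hy := abs_limit_sub_le ht hR hRℓ hZ (hh.trans_lt hhR) hlim hxlim
        (B := 2 * ℓ₀ * t) (by rwa [abs_of_pos hP]) (by rwa [abs_of_pos hx])
      rw [← hK] at hy
      rw [← hh] at hne ⊢
      exact abs_transversality_le ht hℓ hP hPB hx hxB hp1 hp2 (hxq hneg) hy hne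
  have hfin : t * ((ℓ₀ ^ 2 + 1) * ((ℓ₀ + 1) * (ℓ₀ - 1))) = 0 := by
    have hpos : (2 : ℝ) ≠ 0 := two_ne_zero
    refine mul_left_cancel₀ hpos ?_
    linear_combination (t + ℓ₀ ^ 2) * ℓ₀ * hg - P * (t + ℓ₀ ^ 2) * hp1 + 2 * t * hp2
  have : ℓ₀ - 1 ≠ 0 := sub_ne_zero.2 h1
  have h5 : t * ((ℓ₀ ^ 2 + 1) * ((ℓ₀ + 1) * (ℓ₀ - 1))) ≠ 0 :=
    mul_ne_zero (by positivity) (mul_ne_zero (by positivity) (mul_ne_zero (by positivity) this))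
  exact h5 hfin

end Critical

theorem isingDisc_inv (t : ℝ) {r : ℝ} (hr : r ≠ 0) :
    isingDisc t r⁻¹ = isingDisc t r / r ^ 2 := by
  simp only [isingDisc]
  field_simp
  ring

theorem mem_BLY_two_ofReal_iff {t x : ℝ} (ht : 1 < t) (hx : 0 < x) :
    (x : ℂ) ∈ BLY t 2 ↔ 3 ≤ t ∧ (x = 1 ∨ isingDisc t x = 0) := by
  obtain ⟨ℓ, hℓ, rfl⟩ : ∃ ℓ : ℝ, 0 < ℓ ∧ (ℓ ^ 2)⁻¹ = x :=
    ⟨(√x)⁻¹, by positivity, by rw [inv_pow, inv_inv, Real.sq_sqrt hx.le]⟩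
  have hℓ2 : ℓ ^ 2 ≠ 0 := by positivity
  have h1 : (ℓ ^ 2)⁻¹ = 1 ↔ ℓ = 1 := by
    rw [inv_eq_one, pow_eq_one_iff_of_nonneg hℓ.le two_ne_zero]
  have hD : isingDisc t (ℓ ^ 2)⁻¹ = 0 ↔ isingDisc t (ℓ ^ 2) = 0 := by
    rw [isingDisc_inv t hℓ2, div_eq_zero_iff, or_iff_left (pow_ne_zero 2 hℓ2)]
  have hpos : t < 3 → isingDisc t (ℓ ^ 2) ≠ 0 := fun h => by
    have e : isingDisc t (ℓ ^ 2) =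
        4 * t * (ℓ ^ 2 - 1) ^ 2 + (t + 1) ^ 3 * (3 - t) * ℓ ^ 2 := by
      simp only [isingDisc]; ring
    have : 0 < 3 - t := by linarith
    rw [e]
    positivity
  rw [mem_BLY_two_iff t hℓ, h1, hD]
  constructor
  · intro h
    rcases lt_or_ge t 3 with h3 | h3
    · exact absurd h (notMem_closure_isingZeros ht hℓ (Or.inr h3.le) (hpos h3))
    · refine ⟨h3, ?_⟩
      by_contra! hne
      exact notMem_closure_isingZeros ht hℓ (Or.inl hne.1) hne.2 h
  · rintro ⟨h3, h⟩
    by_cases hone : ℓ = 1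
    · rw [hone, Complex.ofReal_one]; exact one_mem_closure_isingZeros h3
    · exact mem_closure_isingZeros_of_isingDisc_eq_zero ht hℓ hone (h.resolve_left hone)

theorem isingDisc_eq_mul {t : ℝ} (ht : 3 ≤ t) (r : ℝ) :
    isingDisc t r = 4 * t * ((r - zcMinus2 t) * (r - zcPlus2 t)) := by
  have hs := Real.sq_sqrt (show 0 ≤ (t ^ 2 - 1) ^ 3 * (t ^ 2 - 9) from
    mul_nonneg (pow_nonneg (by nlinarith) 3) (by nlinarith))
  have h0 : t ≠ 0 := by linarith
  rw [isingDisc, zcMinus2, zcPlus2]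
  field_simp
  linear_combination 4 * hs

theorem isingDisc_eq_zero_iff {t : ℝ} (ht : 3 ≤ t) (r : ℝ) :
    isingDisc t r = 0 ↔ r = zcMinus2 t ∨ r = zcPlus2 t := by
  have h4 : 4 * t ≠ 0 := by positivity
  rw [isingDisc_eq_mul ht, mul_eq_zero, or_iff_right h4, mul_eq_zero, sub_eq_zero, sub_eq_zero]

theorem pos_of_isingDisc_eq_zero {t r : ℝ} (ht : 3 ≤ t) (h : isingDisc t r = 0) : 0 < r := by
  have h1 : 0 < t ^ 4 - 6 * t ^ 2 - 3 := by nlinarith [mul_self_nonneg (t ^ 2 - 9)]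
  rw [isingDisc] at h
  by_contra! hr
  nlinarith [mul_nonneg (show (0 : ℝ) ≤ t by linarith) (sq_nonneg r)]

/-- **Theorem C (rooted case, Ising model `q = 2`).** For `t > 1`, the intersection of the
accumulation set of Lee–Yang zeros of the rooted binary Cayley tree with `(0,∞)` is
empty for `1 < t < 3` and equals `{1, z_c^−(t,2), z_c^+(t,2)}` for `t ≥ 3`. -/
theorem ising_rooted_antiferromagnetic_accumulation (t : ℝ) (ht : 1 < t) :
    (t < 3 → BLY t 2 ∩ posAxis = ∅) ∧
    (3 ≤ t →
      BLY t 2 ∩ posAxis = {(1 : ℂ), ((zcMinus2 t : ℝ) : ℂ), ((zcPlus2 t : ℝ) : ℂ)}) := by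
  refine ⟨fun h3 => ?_, fun h3 => ?_⟩
  · rw [Set.eq_empty_iff_forall_notMem]
    rintro _ ⟨hB, x, hx, rfl⟩
    exact h3.not_ge ((mem_BLY_two_ofReal_iff ht hx).1 hB).1
  · have hmem : ∀ x : ℝ, x = 1 ∨ isingDisc t x = 0 → (x : ℂ) ∈ BLY t 2 ∩ posAxis := fun x h => by
      have hx : 0 < x := h.elim (fun h => h ▸ one_pos) (pos_of_isingDisc_eq_zero h3)
      exact ⟨(mem_BLY_two_ofReal_iff ht hx).2 ⟨h3, h⟩, x, hx, rfl⟩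
    ext z
    simp only [Set.mem_insert_iff, Set.mem_singleton_iff]
    constructor
    · rintro ⟨hB, x, hx, rfl⟩
      have h := ((mem_BLY_two_ofReal_iff ht hx).1 hB).2
      rw [isingDisc_eq_zero_iff h3] at h
      exact_mod_cast h
    · rintro (rfl | rfl | rfl)
      · simpa using hmem 1 (Or.inl rfl)
      · exact hmem _ (Or.inr ((isingDisc_eq_zero_iff h3 _).2 (Or.inl rfl)))
      · exact hmem _ (Or.inr ((isingDisc_eq_zero_iff h3 _).2 (Or.inr rfl)))
end
end

section
/- Let q be a real number with q ≥ 2, let t > 1 and z > 0. If the second iterate R²_{z,t,q} has a neutral fixed point w > 0 (i.e., R²_{z,t,q}(w) = w and |(R²_{z,t,q})'(w)| = 1), then t ≥ t₃(q) and z = z_c^+(t,q) or z = z_c^−(t,q), where z_c^±(t,q) = [(−3 − 6(q−2)t − 3(2+(q−2)q)t² − 6(q−2)(q−1)t³ + (q−1)²t⁴) ± √((t−1)³(1−t+qt)³(−9+18t−9qt−t²+qt²))] / (8t(1−2t+qt)³). Furthermore, for all t ≥ t₃(q): (a) 0 < z_c^−(t,q) ≤ z_c^+(t,q), with equality only when t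 = t₃(q); and (b) if q ≥ 3 then z_c^+(t,q) < 1. -/
noncomputable section

/-- The renormalization map `R_{z,t,q}(w) = z·((t + w + (q−2)tw)/(1 + (q−1)tw))²`,
viewed as a function of the real variable `w`. -/
def Rmap (z t q : ℝ) (w : ℝ) : ℝ :=
  z * ((t + w + (q - 2) * t * w) / (1 + (q - 1) * t * w)) ^ 2

/-- The second iterate `R²_{z,t,q}(w) = R_{z,t,q}(R_{z,t,q}(w))`. -/
def Rmap2 (z t q : ℝ) (w : ℝ) : ℝ := Rmap z t q (Rmap z t q w)

/-- `t₃(q) = 3(3q − 6 + √(9q² − 32q + 32))/(2(q − 1))`. -/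
def tThree (q : ℝ) : ℝ :=
  3 * (3 * q - 6 + Real.sqrt (9 * q ^ 2 - 32 * q + 32)) / (2 * (q - 1))

/-- `z_c^+(t,q)`. -/
def zcPlus (q t : ℝ) : ℝ :=
  ((-3 - 6 * (q - 2) * t - 3 * (2 + (q - 2) * q) * t ^ 2 - 6 * (q - 2) * (q - 1) * t ^ 3
      + (q - 1) ^ 2 * t ^ 4)
    + Real.sqrt ((t - 1) ^ 3 * (1 - t + q * t) ^ 3 * (-9 + 18 * t - 9 * q * t - t ^ 2 + q * t ^ 2)))
    / (8 * t * (1 - 2 * t + q * t) ^ 3)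

/-- `z_c^−(t,q)`. -/
def zcMinus (q t : ℝ) : ℝ :=
  ((-3 - 6 * (q - 2) * t - 3 * (2 + (q - 2) * q) * t ^ 2 - 6 * (q - 2) * (q - 1) * t ^ 3
      + (q - 1) ^ 2 * t ^ 4)
    - Real.sqrt ((t - 1) ^ 3 * (1 - t + q * t) ^ 3 * (-9 + 18 * t - 9 * q * t - t ^ 2 + q * t ^ 2)))
    / (8 * t * (1 - 2 * t + q * t) ^ 3)

/-- For `q ≥ 2` and `t > 0`, `tThree q` is the positive root of `(q-1)t² - 9(q-2)t - 9`. -/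
theorem tThree_le_iff {q t : ℝ} (hq : 2 ≤ q) (ht : 0 < t) :
    tThree q ≤ t ↔ 9 * (1 + (q - 2) * t) ≤ (q - 1) * t * t := by
  have hp : 0 < q - 1 := by linarith
  have hpt : 0 < (q - 1) * t := mul_pos hp ht
  unfold tThree
  set r := Real.sqrt (9 * q ^ 2 - 32 * q + 32) with hr
  have hr2 : r ^ 2 = 9 * q ^ 2 - 32 * q + 32 := Real.sq_sqrt (by nlinarith)
  have hr3 : 3 * (q - 2) ≤ r := Real.le_sqrt_of_sq_le (by nlinarith)
  have key : 4 * (q - 1) * ((q - 1) * t * t - 9 * (1 + (q - 2) * t)) =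
      (2 * (q - 1) * t - 9 * (q - 2) - 3 * r) * (2 * (q - 1) * t - 9 * (q - 2) + 3 * r) := by
    linear_combination 9 * hr2
  have hpos : 0 < 2 * (q - 1) * t - 9 * (q - 2) + 3 * r := by nlinarith
  rw [div_le_iff₀ (by linarith)]
  constructor
  · intro h
    have h' : 0 ≤ 4 * (q - 1) * ((q - 1) * t * t - 9 * (1 + (q - 2) * t)) :=
      key ▸ mul_nonneg (by linarith) hpos.le
    linarith [nonneg_of_mul_nonneg_right h' (by linarith)]
  · intro h
    have h' : 0 ≤ 4 * (q - 1) * ((q - 1) * t * t - 9 * (1 + (q - 2) * t)) :=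
      mul_nonneg (by linarith) (by linarith)
    rw [key] at h'
    linarith [nonneg_of_mul_nonneg_left h' hpos]

theorem one_lt_tThree {q : ℝ} (hq : 2 ≤ q) : 1 < tThree q := by
  by_contra! h
  have := (tThree_le_iff hq one_pos).1 h
  linarith

theorem eq_tThree_of_discr_eq_zero {q t : ℝ} (hq : 2 ≤ q) (ht : 0 < t)
    (h : (q - 1) * t * t = 9 * (1 + (q - 2) * t)) : t = tThree q := by
  refine le_antisymm ?_ ((tThree_le_iff hq ht).2 h.ge)
  have h3 : 1 < tThree q := one_lt_tThree hq
  have h4 := (tThree_le_iff hq (by linarith)).1 (le_refl (tThree q))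
  by_contra! hlt
  nlinarith [mul_pos ht (sub_pos.2 hlt), mul_pos (mul_pos ht (sub_pos.2 hlt)) (by linarith : 0 < q - 1)]

theorem hasDerivAt_Rmap (z t q : ℝ) {w : ℝ} (hw : 1 + (q - 1) * t * w ≠ 0) :
    HasDerivAt (Rmap z t q)
      (-(2 * z * ((t + w + (q - 2) * t * w) / (1 + (q - 1) * t * w)) *
        ((t - 1) * (1 - t + q * t)) / (1 + (q - 1) * t * w) ^ 2)) w := by
  have h1 : HasDerivAt (fun w : ℝ => t + w + (q - 2) * t * w) (1 + (q - 2) * t) w := by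
    simpa using ((hasDerivAt_id' w).const_add t).fun_add ((hasDerivAt_id' w).const_mul ((q - 2) * t))
  have h2 : HasDerivAt (fun w : ℝ => 1 + (q - 1) * t * w) ((q - 1) * t) w := by
    simpa using ((hasDerivAt_id w).const_mul ((q - 1) * t)).const_add 1
  refine (((h1.fun_div h2 hw).fun_pow 2).const_mul z).congr_deriv ?_
  have hdet : (1 + (q - 2) * t) * (1 + (q - 1) * t * w) -
      (t + w + (q - 2) * t * w) * ((q - 1) * t) = -((t - 1) * (1 - t + q * t)) := by ring
  rw [hdet]
  push_cast
  ring

/-- A two-cycle of `x ↦ (t + c x²) / (1 + d x²)` with multiplier one is a fixed point. -/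
theorem eq_of_neutral_two_cycle {t c d u v : ℝ} (hu : 0 < u) (hv : 0 < v) (hcd : 0 < c ^ 2 + d)
    (h₁ : u * (1 + d * v ^ 2) = t + c * v ^ 2) (h₂ : v * (1 + d * u ^ 2) = t + c * u ^ 2)
    (h₃ : 4 * u * v * (d * t - c) ^ 2 = ((1 + d * u ^ 2) * (1 + d * v ^ 2)) ^ 2) : u = v := by
  by_contra hne
  have hsub : u - v ≠ 0 := sub_ne_zero.2 hne
  have hP : d * (u * v) = 1 + c * (u + v) := by
    apply mul_left_cancel₀ hsub
    linear_combination h₂ - h₁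
  have hS : u + v = t - c * (u * v) := by
    linear_combination (h₁ + h₂) / 2 - (u + v) / 2 * hP
  have hK : d * t - c = (c ^ 2 + d) * (u + v) := by
    linear_combination -d * hS + c * hP
  have hQ : (1 + d * u ^ 2) * (1 + d * v ^ 2) = (c ^ 2 + d) * (u + v) ^ 2 := by
    linear_combination (d * (u * v) + 1 + c * (u + v) - 2) * hP
  rw [hK, hQ] at h₃
  have h4 : 4 * u * v = (u + v) ^ 2 := by
    have : ((c ^ 2 + d) * (u + v)) ^ 2 ≠ 0 := by positivity
    apply mul_right_cancel₀ this
    linear_combination h₃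
  exact pow_ne_zero 2 hsub (by linear_combination -h4)

theorem zcPlus_eq (q t : ℝ) : zcPlus q t =
    ((((q - 1) * t * t) ^ 2 - 6 * ((q - 1) * t * t) * (1 + (q - 2) * t) - 3 * (1 + (q - 2) * t) ^ 2) +
      Real.sqrt (((q - 1) * t * t - (1 + (q - 2) * t)) ^ 3 *
        ((q - 1) * t * t - 9 * (1 + (q - 2) * t)))) / (8 * t * (1 + (q - 2) * t) ^ 3) := by
  unfold zcPlus
  congr 1
  · congr 1
    · ring
    · congr 1; ring
  · ring

theorem zcMinus_eq (q t : ℝ) : zcMinus q t =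
    ((((q - 1) * t * t) ^ 2 - 6 * ((q - 1) * t * t) * (1 + (q - 2) * t) - 3 * (1 + (q - 2) * t) ^ 2) -
      Real.sqrt (((q - 1) * t * t - (1 + (q - 2) * t)) ^ 3 *
        ((q - 1) * t * t - 9 * (1 + (q - 2) * t)))) / (8 * t * (1 + (q - 2) * t) ^ 3) := by
  unfold zcMinus
  congr 1
  · congr 1
    · ring
    · congr 1; ring
  · ring

/-- A fixed point `w` of `R` at which the multiplier has square one satisfies a quadratic equation
whose solvability over the positive reals bounds the parameters, and determines `z`. -/
theorem neutral_fixed_point_parameters {t z a b w : ℝ} (ht : 0 < t) (ha : 0 < a)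
    (hw : 0 < w) (hab : a < b * t) (hfix : w * (1 + b * w) ^ 2 = z * (t + a * w) ^ 2)
    (hmul : 2 * w * (b * t - a) = (t + a * w) * (1 + b * w)) :
    9 * a ≤ b * t ∧
      (8 * t * a ^ 3 * z - ((b * t) ^ 2 - 6 * (b * t) * a - 3 * a ^ 2)) ^ 2 =
        (b * t - a) ^ 3 * (b * t - 9 * a) := by
  have hE : a * b * w ^ 2 + (3 * a - b * t) * w + t = 0 := by linear_combination -hmul
  have hsq : (2 * (a * b) * w - b * t + 3 * a) ^ 2 = (b * t - a) * (b * t - 9 * a) := by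
    linear_combination 4 * a * b * hE
  constructor
  · have := sq_nonneg (2 * (a * b) * w - b * t + 3 * a)
    rw [hsq] at this
    linarith [nonneg_of_mul_nonneg_right this (sub_pos.2 hab)]
  · have hz : 8 * t * a ^ 3 * z = (b * t) ^ 2 - 6 * (b * t) * a - 3 * a ^ 2 +
        (b * t - a) * (2 * (a * b) * w - b * t + 3 * a) := by
      have : (t + a * w) ^ 2 ≠ 0 := by positivity
      apply mul_right_cancel₀ this
      linear_combination (-8 * t * a ^ 3) * hfix - (-2 * a ^ 2 * (3 * (b * t) + a) * w - 2 * a * t * (b * t + 3 * a)) * hE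
    rw [hz]
    linear_combination (b * t - a) ^ 2 * hsq

theorem eq_zcPlus_or_eq_zcMinus {q t z : ℝ} (ht : 0 < t) (ha : 0 < 1 + (q - 2) * t)
    (h : (8 * t * (1 + (q - 2) * t) ^ 3 * z - (((q - 1) * t * t) ^ 2 -
        6 * ((q - 1) * t * t) * (1 + (q - 2) * t) - 3 * (1 + (q - 2) * t) ^ 2)) ^ 2 =
      ((q - 1) * t * t - (1 + (q - 2) * t)) ^ 3 * ((q - 1) * t * t - 9 * (1 + (q - 2) * t))) :
    z = zcPlus q t ∨ z = zcMinus q t := by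
  have hD : 0 < 8 * t * (1 + (q - 2) * t) ^ 3 := by positivity
  rw [zcPlus_eq, zcMinus_eq, eq_div_iff hD.ne', eq_div_iff hD.ne', ← h, Real.sqrt_sq_eq_abs]
  rcases abs_choice (8 * t * (1 + (q - 2) * t) ^ 3 * z - (((q - 1) * t * t) ^ 2 -
        6 * ((q - 1) * t * t) * (1 + (q - 2) * t) - 3 * (1 + (q - 2) * t) ^ 2)) with h | h <;>
    rw [h]
  · left; ring
  · right; ring

/-- In the antiferromagnetic regime, a neutral fixed point of the second iterate is a fixed point of
`R` itself. -/
theorem neutral_fixed_point_Rmap2 {q t z w : ℝ} (hq : 2 ≤ q) (ht : 1 < t) (hz : 0 < z) (hw : 0 < w)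
    (hfix : Rmap2 z t q w = w) (hder : |deriv (Rmap2 z t q) w| = 1) :
    w * (1 + (q - 1) * t * w) ^ 2 = z * (t + (1 + (q - 2) * t) * w) ^ 2 ∧
      2 * w * ((q - 1) * t * t - (1 + (q - 2) * t)) =
        (t + (1 + (q - 2) * t) * w) * (1 + (q - 1) * t * w) := by
  have hs : 0 ≤ q - 2 := by linarith
  have hp : 0 < q - 1 := by linarith
  have ht0 : 0 < t := by linarith
  have hK : 0 < (t - 1) * (1 - t + q * t) := mul_pos (by linarith) (by nlinarith)
  have hA : 0 < 1 + (q - 1) * t * w := by positivity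
  obtain ⟨u, hu⟩ : ∃ u, u = (t + w + (q - 2) * t * w) / (1 + (q - 1) * t * w) := ⟨_, rfl⟩
  have hu0 : 0 < u := hu ▸ by positivity
  have hRw : Rmap z t q w = z * u ^ 2 := by rw [hu]; rfl
  have hB : 0 < 1 + (q - 1) * t * (z * u ^ 2) := by positivity
  have hd1 := hasDerivAt_Rmap z t q hA.ne'
  have hd2 : HasDerivAt (Rmap z t q) _ (Rmap z t q w) :=
    hasDerivAt_Rmap z t q (by rw [hRw]; exact hB.ne')
  have hd : deriv (Rmap2 z t q) w = _ := (hd2.comp w hd1).deriv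
  obtain ⟨v, hv⟩ : ∃ v, v = (t + z * u ^ 2 + (q - 2) * t * (z * u ^ 2)) /
    (1 + (q - 1) * t * (z * u ^ 2)) := ⟨_, rfl⟩
  have hv0 : 0 < v := hv ▸ by positivity
  have hwv : w = z * v ^ 2 := by
    rw [← hfix, Rmap2, hRw, hv]; rfl
  rw [hRw, ← hu, ← hv, hwv] at hd
  rw [hwv] at hA hu
  rw [← hwv, neg_mul_neg, hwv] at hd
  rw [hwv, hd, abs_of_pos (by positivity), div_mul_div_comm, div_eq_one_iff_eq (by positivity)] at hder
  rw [eq_div_iff hA.ne'] at hu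
  rw [eq_div_iff hB.ne'] at hv
  have huv : u = v := by
    refine eq_of_neutral_two_cycle (t := t) (c := z * (1 + (q - 2) * t)) (d := z * ((q - 1) * t))
      hu0 hv0 (by positivity) ?_ ?_ ?_
    · linear_combination hu
    · linear_combination hv
    · linear_combination hder
  subst huv
  have hmul : 2 * z * u * ((t - 1) * (1 - t + q * t)) = (1 + (q - 1) * t * (z * u ^ 2)) ^ 2 := by
    rw [← sq_eq_sq₀ (by positivity) (by positivity)]
    linear_combination hder
  rw [hwv]
  constructor
  · linear_combination (z * (u * (1 + (q - 1) * t * (z * u ^ 2)) +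
      (t + (1 + (q - 2) * t) * (z * u ^ 2)))) * hu
  · linear_combination u * hmul + (1 + (q - 1) * t * (z * u ^ 2)) * hu

theorem zcMinus_pos {q t : ℝ} (hq : 2 ≤ q) (h : tThree q ≤ t) : 0 < zcMinus q t := by
  have ht : 1 < t := (one_lt_tThree hq).trans_le h
  have ht0 : 0 < t := by linarith
  have hX := (tThree_le_iff hq ht0).1 h
  have ha : 0 < 1 + (q - 2) * t := by nlinarith
  rw [zcMinus_eq]
  generalize (q - 1) * t * t = X at hX ⊢
  generalize 1 + (q - 2) * t = a at hX ha ⊢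
  have hXpos : 0 < X := by linarith
  refine div_pos (sub_pos.2 ((Real.sqrt_lt' (by nlinarith)).2 ?_)) (by positivity)
  have : 0 < 64 * X * a ^ 3 := by positivity
  linear_combination this

theorem zcMinus_le_zcPlus {q t : ℝ} (ht : 0 < t) (ha : 0 < 1 + (q - 2) * t) :
    zcMinus q t ≤ zcPlus q t := by
  rw [zcMinus_eq, zcPlus_eq]
  gcongr
  linarith [Real.sqrt_nonneg (((q - 1) * t * t - (1 + (q - 2) * t)) ^ 3 *
    ((q - 1) * t * t - 9 * (1 + (q - 2) * t)))]

theorem eq_tThree_of_zcMinus_eq_zcPlus {q t : ℝ} (hq : 2 ≤ q) (h : tThree q ≤ t)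
    (heq : zcMinus q t = zcPlus q t) : t = tThree q := by
  have ht : 1 < t := (one_lt_tThree hq).trans_le h
  have ht0 : 0 < t := by linarith
  have hX := (tThree_le_iff hq ht0).1 h
  have ha : 0 < 1 + (q - 2) * t := by nlinarith
  have hD : 0 < 8 * t * (1 + (q - 2) * t) ^ 3 := by positivity
  rw [zcMinus_eq, zcPlus_eq, div_left_inj' hD.ne'] at heq
  have hXa : 0 < (q - 1) * t * t - (1 + (q - 2) * t) := by linarith
  have h0 : Real.sqrt (((q - 1) * t * t - (1 + (q - 2) * t)) ^ 3 *
    ((q - 1) * t * t - 9 * (1 + (q - 2) * t))) = 0 := by linarith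
  rw [Real.sqrt_eq_zero (mul_nonneg (pow_nonneg hXa.le 3) (by linarith))] at h0
  have := (mul_eq_zero.1 h0).resolve_left (pow_ne_zero 3 hXa.ne')
  exact eq_tThree_of_discr_eq_zero hq ht0 (by linarith)

theorem zcPlus_lt_one {q t : ℝ} (hq : 3 ≤ q) (h : tThree q ≤ t) : zcPlus q t < 1 := by
  have hq2 : 2 ≤ q := by linarith
  have ht : 1 < t := (one_lt_tThree hq2).trans_le h
  have ht0 : 0 < t := by linarith
  obtain ⟨s, hs, rfl⟩ : ∃ s : ℝ, 0 ≤ s ∧ q = s + 3 := ⟨q - 3, by linarith, by ring⟩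
  have ha : 0 < 1 + (s + 3 - 2) * t := by nlinarith
  rw [zcPlus_eq, div_lt_one (by positivity), ← lt_sub_iff_add_lt']
  have hN : ((s + 3 - 1) * t * t) ^ 2 - 6 * ((s + 3 - 1) * t * t) * (1 + (s + 3 - 2) * t) -
      3 * (1 + (s + 3 - 2) * t) ^ 2 < 4 * t * (1 + (s + 3 - 2) * t) ^ 3 := by
    rw [← sub_pos]
    ring_nf
    positivity
  have hp : 0 < 4 * t * (1 + (s + 3 - 2) * t) ^ 3 := by positivity
  have hc : 0 < 16 * t * (1 + (s + 3 - 2) * t) ^ 3 * (4 * (s + 3 - 1) * t) :=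
    mul_pos (by positivity) (by nlinarith)
  rw [Real.sqrt_lt' (by linarith)]
  nlinarith [mul_pos hp (sub_pos.2 hN)]

/-- **Lemma (neutral fixed points of the second iterate, antiferromagnetic case).**
Let `q ≥ 2` be real.  If `t > 1`, `z > 0`, and the second iterate `R²_{z,t,q}` has a
neutral fixed point `w > 0` (i.e. `R²_{z,t,q}(w) = w` and `|(R²_{z,t,q})'(w)| = 1`),
then `t ≥ t₃(q)` and `z = z_c^+(t,q)` or `z = z_c^−(t,q)`.  Furthermore, for all
`t ≥ t₃(q)`: (a) `0 < z_c^−(t,q) ≤ z_c^+(t,q)` with equality only when `t = t₃(q)`,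
and (b) if `q ≥ 3` then `z_c^+(t,q) < 1`. -/
theorem second_iterate_neutral_fixed_point_classification (q : ℝ) (hq : 2 ≤ q) :
    (∀ t z : ℝ, 1 < t → 0 < z →
      (∃ w : ℝ, 0 < w ∧ Rmap2 z t q w = w ∧ |deriv (Rmap2 z t q) w| = 1) →
      tThree q ≤ t ∧ (z = zcPlus q t ∨ z = zcMinus q t)) ∧
    (∀ t : ℝ, tThree q ≤ t →
      (0 < zcMinus q t ∧ zcMinus q t ≤ zcPlus q t ∧
        (zcMinus q t = zcPlus q t → t = tThree q)) ∧
      (3 ≤ q → zcPlus q t < 1)) := by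
  refine ⟨?_, fun t h => ?_⟩
  · rintro t z ht hz ⟨w, hw, hfix, hder⟩
    have ht0 : 0 < t := by linarith
    have ha : 0 < 1 + (q - 2) * t := by nlinarith
    obtain ⟨h₁, h₂⟩ := neutral_fixed_point_Rmap2 hq ht hz hw hfix hder
    obtain ⟨h₃, h₄⟩ := neutral_fixed_point_parameters ht0 ha hw (by nlinarith) h₁ h₂
    exact ⟨(tThree_le_iff hq ht0).2 h₃, eq_zcPlus_or_eq_zcMinus ht0 ha h₄⟩
  · have ht0 : 0 < t := by linarith [one_lt_tThree hq]
    exact ⟨⟨zcMinus_pos hq h, zcMinus_le_zcPlus ht0 (by nlinarith),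
      eq_tThree_of_zcMinus_eq_zcPlus hq h⟩, fun hq3 => zcPlus_lt_one hq3 h⟩
end
end

section
/- Let q be a real number with q ≥ 2, let t ∈ (0, t₂(q)), and let z = N₊(t,q) or z = N₋(t,q). Then R_{z,t,q} has exactly two fixed points on [0,∞); one of them, w_N, is neutral (R'_{z,t,q}(w_N) = 1, corresponding to a double root of the fixed-point equation), and the other, w_A, is attracting with 0 < R'_{z,t,q}(w_A) < 1. -/
noncomputable section

/-- `t₂(q) = (q − 2 + √(q² + 32q − 32))/(18(q − 1))`. -/
def tTwo (q : ℝ) : ℝ := (q - 2 + Real.sqrt (q ^ 2 + 32 * q - 32)) / (18 * (q - 1))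

/-- `N₊(t,q)`. -/
def Nplus (q t : ℝ) : ℝ :=
  ((-27 * (q - 1) ^ 2 * t ^ 4 + 18 * (q ^ 2 - 3 * q + 2) * t ^ 3
      + (q ^ 2 + 14 * q - 14) * t ^ 2 + 2 * (q - 2) * t + 1)
    + Real.sqrt ((t - 1) * ((q - 1) * t + 1) * (9 * (q - 1) * t ^ 2 - (q - 2) * t - 1) ^ 3))
    / (8 * t * ((q - 2) * t + 1) ^ 3)

/-- `N₋(t,q)`. -/
def Nminus (q t : ℝ) : ℝ :=
  ((-27 * (q - 1) ^ 2 * t ^ 4 + 18 * (q ^ 2 - 3 * q + 2) * t ^ 3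
      + (q ^ 2 + 14 * q - 14) * t ^ 2 + 2 * (q - 2) * t + 1)
    - Real.sqrt ((t - 1) * ((q - 1) * t + 1) * (9 * (q - 1) * t ^ 2 - (q - 2) * t - 1) ^ 3))
    / (8 * t * ((q - 2) * t + 1) ^ 3)

/-- If `w` is a double root of the fixed-point equation, it splits with third root `v`. -/
lemma fixedPoint_cubic_factor {a b t z w v : ℝ} (hw : w ≠ 0) (htw : t + a * w ≠ 0)
    (hquad : a * b * w ^ 2 - (a - 3 * t * b) * w + t = 0)
    (hfix : z * (t + a * w) ^ 2 = w * (1 + b * w) ^ 2)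
    (hv : b ^ 2 * w ^ 2 * v = z * t ^ 2) (x : ℝ) :
    x * (1 + b * x) ^ 2 - z * (t + a * x) ^ 2 = b ^ 2 * (x - w) ^ 2 * (x - v) := by
  have hder : (1 + b * w) * (1 + 3 * b * w) - 2 * a * z * (t + a * w) = 0 := by
    apply mul_left_cancel₀ htw
    linear_combination (1 + b * w) * hquad - 2 * a * hfix
  apply mul_left_cancel₀ (pow_ne_zero 2 hw)
  linear_combination (x ^ 2 * w - x * w ^ 2) * hder + (x ^ 2 - 2 * x * w) * hfix
    + (x - w) ^ 2 * hv

/-- Derivative of the square of a Möbius map. -/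
lemma hasDerivAt_mul_moebius_sq {a b t z x : ℝ} (hx : 1 + b * x ≠ 0) :
    HasDerivAt (fun w : ℝ => z * ((t + a * w) / (1 + b * w)) ^ 2)
      (2 * z * (t + a * x) * (a - t * b) / (1 + b * x) ^ 3) x := by
  have h1 : HasDerivAt (fun w : ℝ => t + a * w) a x := by
    simpa using ((hasDerivAt_id x).const_mul a).const_add t
  have h2 : HasDerivAt (fun w : ℝ => 1 + b * w) b x := by
    simpa using ((hasDerivAt_id x).const_mul b).const_add 1
  refine (((h1.div h2 hx).pow 2).const_mul z).congr_deriv ?_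
  simp only [Pi.div_apply, Nat.reduceSub, pow_one, Nat.cast_ofNat]
  field_simp
  ring

/-- Fixed points of the square of a Möbius map with a prescribed positive neutral point. -/
lemma moebius_sq_fixedPoints {a b t z w : ℝ} (ha : 0 < a) (hb : 0 < b) (ht : 0 < t)
    (hE : 0 < a - 9 * t * b) (hw : 0 < w)
    (hquad : a * b * w ^ 2 - (a - 3 * t * b) * w + t = 0)
    (hfix : z * (t + a * w) ^ 2 = w * (1 + b * w) ^ 2)
    {f : ℝ → ℝ} (hf : f = fun w => z * ((t + a * w) / (1 + b * w)) ^ 2) :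
    ∃ wN wA : ℝ, 0 ≤ wN ∧ 0 ≤ wA ∧ wN ≠ wA ∧ f wN = wN ∧ f wA = wA ∧
      (∀ x : ℝ, 0 ≤ x → f x = x → x = wN ∨ x = wA) ∧
      deriv f wN = 1 ∧ 0 < deriv f wA ∧ deriv f wA < 1 := by
  have htb : 0 < t * b := mul_pos ht hb
  have hD : 0 < a - t * b := by linarith
  have htw : 0 < t + a * w := by positivity
  have hz : 0 < z := by
    have h : 0 < z * (t + a * w) ^ 2 := by rw [hfix]; positivity
    exact pos_of_mul_pos_left h (by positivity)
  obtain ⟨v, hv⟩ : ∃ v, v = z * t ^ 2 / (b ^ 2 * w ^ 2) := ⟨_, rfl⟩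
  have hv0 : 0 < v := by rw [hv]; positivity
  have hv' : b ^ 2 * w ^ 2 * v = z * t ^ 2 := by rw [hv]; field_simp
  have hne : w ≠ v := by
    intro h
    rw [← h] at hv'
    have hsq : (b * w * (t + a * w)) ^ 2 = (t * (1 + b * w)) ^ 2 := by
      apply mul_left_cancel₀ hw.ne'
      linear_combination (t + a * w) ^ 2 * hv' + t ^ 2 * hfix
    have heq := (pow_left_inj₀ (by positivity) (by positivity) two_ne_zero).1 hsq
    have h1 : a * b * w ^ 2 = t := by linear_combination heq
    have h2 : (a - 3 * t * b) * w = 2 * t := by linear_combination h1 - hquad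
    have h3 : (a - t * b) * (a - 9 * t * b) * w ^ 2 = 0 := by
      linear_combination ((a - 3 * t * b) * w + 2 * t) * h2 - 4 * t * h1
    have : 0 < (a - t * b) * (a - 9 * t * b) * w ^ 2 := by positivity
    linarith
  have hfac := fixedPoint_cubic_factor hw.ne' htw.ne' hquad hfix hv'
  have hiff : ∀ x, 0 ≤ x → (f x = x ↔ b ^ 2 * (x - w) ^ 2 * (x - v) = 0) := by
    intro x hx
    have hx1 : 0 < 1 + b * x := by positivity
    rw [← hfac x, hf]
    dsimp only
    rw [div_pow, ← mul_div_assoc, div_eq_iff (by positivity), sub_eq_zero, eq_comm]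
  have hderiv : ∀ x, 0 ≤ x →
      deriv f x = 2 * z * (t + a * x) * (a - t * b) / (1 + b * x) ^ 3 := by
    intro x hx
    rw [hf]
    exact (hasDerivAt_mul_moebius_sq (by positivity)).deriv
  have hvfix : v * (1 + b * v) ^ 2 - z * (t + a * v) ^ 2 = 0 := by simp [hfac v]
  have hslope : (1 + b * v) * (1 + 3 * b * v) - 2 * a * z * (t + a * v)
      = b ^ 2 * (v - w) ^ 2 := by
    linear_combination (4 / 3) * (hfac (v + 1) - hfac (v - 1)) / 2
      - (hfac (v + 2) - hfac (v - 2)) / 12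
  refine ⟨w, v, hw.le, hv0.le, hne, (hiff w hw.le).2 (by simp), (hiff v hv0.le).2 (by simp),
    ?_, ?_, ?_, ?_⟩
  · intro x hx h
    rcases mul_eq_zero.1 ((hiff x hx).1 h) with h | h
    · left
      have := (mul_eq_zero.1 h).resolve_left (by positivity)
      exact sub_eq_zero.1 (pow_eq_zero_iff two_ne_zero |>.1 this)
    · exact Or.inr (sub_eq_zero.1 h)
  · rw [hderiv w hw.le, div_eq_one_iff_eq (by positivity)]
    apply mul_left_cancel₀ htw.ne'
    linear_combination 2 * (a - t * b) * hfix - (1 + b * w) ^ 2 * hquad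
  · rw [hderiv v hv0.le]
    positivity
  · rw [hderiv v hv0.le, div_lt_one (by positivity)]
    have hpos : 0 < (1 + b * v) * (b ^ 2 * (v - w) ^ 2) := by
      have : 0 < (v - w) ^ 2 := by
        have := sub_ne_zero.2 hne.symm
        positivity
      positivity
    rw [← hslope] at hpos
    linarith [congrArg (fun y => 2 * b * y) hvfix]

/-- The positive neutral point belonging to a signed square root `s` of the discriminant. -/
lemma exists_neutral_of_discriminant {a b t s z : ℝ} (ha : 0 < a) (hb : 0 < b) (ht : 0 < t)
    (hE : 0 < a - 9 * t * b) (hs : s ^ 2 = (a - t * b) * (a - 9 * t * b))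
    (hz : z = (a ^ 2 + 18 * a * b * t - 27 * b ^ 2 * t ^ 2 + (a - 9 * t * b) * s)
      / (8 * t * a ^ 3)) :
    ∃ w, 0 < w ∧ a * b * w ^ 2 - (a - 3 * t * b) * w + t = 0 ∧
      z * (t + a * w) ^ 2 = w * (1 + b * w) ^ 2 := by
  have htb : 0 < t * b := mul_pos ht hb
  have hlt : s < a - 3 * t * b := by
    apply lt_of_pow_lt_pow_left₀ 2 (by linarith)
    have : 0 < a * (t * b) := mul_pos ha htb
    rw [hs]
    linarith
  refine ⟨(a - 3 * t * b - s) / (2 * a * b), div_pos (by linarith) (by positivity), ?_, ?_⟩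
  · field_simp
    linear_combination hs
  · rw [hz]
    field_simp
    linear_combination 2 * ((a - 5 * t * b) * s - (a - t * b) * (a - 9 * t * b)) * hs

/-- Below `tTwo q` the quadratic vanishing at `tTwo q` keeps its sign. -/
lemma pos_of_lt_tTwo {q t : ℝ} (hq : 2 ≤ q) (ht0 : 0 < t) (ht : t < tTwo q) :
    0 < 1 + (q - 2) * t - 9 * t * ((q - 1) * t) := by
  have hp : 0 < q - 1 := by linarith
  rw [tTwo, lt_div_iff₀ (by positivity)] at ht
  rcases le_or_gt (18 * (q - 1) * t) (q - 2) with h | h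
  · nlinarith [mul_nonneg ht0.le (sub_nonneg.2 h), mul_pos hp (pow_pos ht0 2)]
  · have h1 : 18 * (q - 1) * t - (q - 2) < √(q ^ 2 + 32 * q - 32) := by linarith
    have h2 := (Real.lt_sqrt (by linarith)).1 h1
    have h3 : 0 < 36 * (q - 1) * (1 + (q - 2) * t - 9 * t * ((q - 1) * t)) := by linarith
    exact pos_of_mul_pos_right h3 (by positivity)

/-- **Lemma (structure of the fixed points at `z = N_±(t,q)`).**
Let `q ≥ 2` be real, `t ∈ (0, t₂(q))`, and `z = N₊(t,q)` or `z = N₋(t,q)`.  Then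
`R_{z,t,q}` has exactly two fixed points on `[0,∞)`; one of them, `w_N`, is neutral
(`R'_{z,t,q}(w_N) = 1`), and the other, `w_A`, is attracting with
`0 < R'_{z,t,q}(w_A) < 1`. -/
theorem fixed_points_at_Npm
    (q : ℝ) (hq : 2 ≤ q) (t : ℝ) (ht0 : 0 < t) (ht2 : t < tTwo q)
    (z : ℝ) (hz : z = Nplus q t ∨ z = Nminus q t) :
    ∃ wN wA : ℝ, 0 ≤ wN ∧ 0 ≤ wA ∧ wN ≠ wA ∧
      Rmap z t q wN = wN ∧ Rmap z t q wA = wA ∧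
      (∀ w : ℝ, 0 ≤ w → Rmap z t q w = w → w = wN ∨ w = wA) ∧
      deriv (Rmap z t q) wN = 1 ∧
      0 < deriv (Rmap z t q) wA ∧ deriv (Rmap z t q) wA < 1 := by
  have hb : 0 < (q - 1) * t := mul_pos (by linarith) ht0
  have ha : 0 < 1 + (q - 2) * t := by nlinarith
  have hE := pos_of_lt_tTwo hq ht0 ht2
  have hD : 0 < 1 + (q - 2) * t - t * ((q - 1) * t) := by
    linarith [mul_pos ht0 hb]
  have hsqrt : √((t - 1) * ((q - 1) * t + 1) * (9 * (q - 1) * t ^ 2 - (q - 2) * t - 1) ^ 3)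
      = (1 + (q - 2) * t - 9 * t * ((q - 1) * t)) *
        √((1 + (q - 2) * t - t * ((q - 1) * t)) *
          (1 + (q - 2) * t - 9 * t * ((q - 1) * t))) := by
    rw [← Real.sqrt_sq hE.le, ← Real.sqrt_mul (sq_nonneg _), Real.sqrt_sq hE.le]
    congr 1
    ring
  obtain ⟨s, hs, hzs⟩ : ∃ s, s ^ 2 = (1 + (q - 2) * t - t * ((q - 1) * t)) *
        (1 + (q - 2) * t - 9 * t * ((q - 1) * t)) ∧
      z = ((1 + (q - 2) * t) ^ 2 + 18 * (1 + (q - 2) * t) * ((q - 1) * t) * t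
        - 27 * ((q - 1) * t) ^ 2 * t ^ 2 + (1 + (q - 2) * t - 9 * t * ((q - 1) * t)) * s)
        / (8 * t * (1 + (q - 2) * t) ^ 3) := by
    rcases hz with hz | hz
    · refine ⟨_, Real.sq_sqrt (mul_pos hD hE).le, ?_⟩
      rw [hz, Nplus, hsqrt]
      congr 1 <;> ring
    · refine ⟨-√_, (neg_sq _).trans (Real.sq_sqrt (mul_pos hD hE).le), ?_⟩
      rw [hz, Nminus, hsqrt]
      congr 1 <;> ring
  obtain ⟨w, hw, hquad, hfix⟩ := exists_neutral_of_discriminant ha hb ht0 hE hs hzs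
  refine moebius_sq_fixedPoints ha hb ht0 hE hw hquad hfix ?_
  funext x
  rw [Rmap]
  ring_nf
end
end

section
/- Let q ∈ ℕ with q ≥ 2 and set t₁(q) = 1/(1+q), t₂(q) = (q − 2 + √(q² + 32q − 32))/(18(q − 1)). (i) If t ∈ (0, t₂(q)) and z = N₊(t,q), then the orbit (R_{z,t,q}ⁿ(z))_{n≥0} converges to a fixed point w_A of R_{z,t,q} with 0 < R'_{z,t,q}(w_A) < 1 (an attracting fixed point). (ii) If t ∈ (0, t₁(q)) and z = N₋(t,q), then likewise the orbit of z under R_{z,t,q} converges to an attracting fixed point w_A of R_{z,t,q}. -/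
noncomputable section

/-- `t₁(q) = 1/(1+q)`. -/
def tOne (q : ℝ) : ℝ := 1 / (1 + q)

open Filter Set Topology

section Iterate

variable {α : Type*} [ConditionallyCompleteLinearOrder α] [TopologicalSpace α] [OrderTopology α]

/-- A monotone continuous map on `[x, p]` that fixes `p` and moves every other point up
has all of its orbit of `x` converging to `p`. -/
theorem tendsto_iterate_of_lt_map {f : α → α} {x p : α} (hxp : x ≤ p)
    (hmono : MonotoneOn f (Icc x p)) (hcont : ContinuousOn f (Icc x p)) (hp : f p = p)
    (hlt : ∀ y, x ≤ y → y < p → y < f y) :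
    Tendsto (fun n : ℕ => f^[n] x) atTop (𝓝 p) := by
  have hle : ∀ y ∈ Icc x p, y ≤ f y := fun y hy => by
    rcases hy.2.eq_or_lt with rfl | h
    · exact hp.ge
    · exact (hlt y hy.1 h).le
  have hmem : ∀ n : ℕ, f^[n] x ∈ Icc x p := by
    intro n
    induction n with
    | zero => exact ⟨le_rfl, hxp⟩
    | succ n ih =>
      rw [Function.iterate_succ_apply']
      exact ⟨ih.1.trans (hle _ ih), (hmono ih ⟨hxp, le_rfl⟩ ih.2).trans hp.le⟩
  have hm : Monotone (fun n : ℕ => f^[n] x) := monotone_nat_of_le_succ fun n => by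
    rw [Function.iterate_succ_apply']
    exact hle _ (hmem n)
  have hbdd : BddAbove (range fun n : ℕ => f^[n] x) :=
    ⟨p, by rintro _ ⟨n, rfl⟩; exact (hmem n).2⟩
  have hlim := tendsto_atTop_ciSup hm hbdd
  set L := ⨆ n : ℕ, f^[n] x
  have hL : L ∈ Icc x p := isClosed_Icc.mem_of_tendsto hlim (Eventually.of_forall hmem)
  have hfL : Tendsto (fun n : ℕ => f (f^[n] x)) atTop (𝓝 (f L)) :=
    (hcont L hL).tendsto.comp
      (tendsto_nhdsWithin_iff.2 ⟨hlim, Eventually.of_forall hmem⟩)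
  have hfix : f L = L := tendsto_nhds_unique hfL <| by
    simpa only [Function.comp_def, Function.iterate_succ_apply'] using
      hlim.comp (tendsto_add_atTop_nat 1)
  have hLp : L = p := by
    by_contra hne
    exact (hlt L hL.1 (lt_of_le_of_ne hL.2 hne)).ne' hfix
  rwa [hLp] at hlim

/-- Order dual of `tendsto_iterate_of_lt_map`. -/
theorem tendsto_iterate_of_map_lt {f : α → α} {x p : α} (hpx : p ≤ x)
    (hmono : MonotoneOn f (Icc p x)) (hcont : ContinuousOn f (Icc p x)) (hp : f p = p)
    (hlt : ∀ y, y ≤ x → p < y → f y < y) :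
    Tendsto (fun n : ℕ => f^[n] x) atTop (𝓝 p) :=
  tendsto_iterate_of_lt_map (α := αᵒᵈ) (f := f) (x := x) (p := p) hpx
    (fun _ ha _ hb hab => hmono ⟨hb.2, hb.1⟩ ⟨ha.2, ha.1⟩ hab)
    (hcont.mono fun _ hy => ⟨hy.2, hy.1⟩) hp hlt

end Iterate

/-- The square of a Möbius map, scaled by `z`; every `Rmap` is of this form. -/
def sqMobius (z t a b w : ℝ) : ℝ := z * ((t + a * w) / (1 + b * w)) ^ 2

theorem Rmap_eq_sqMobius (z t q : ℝ) :
    Rmap z t q = sqMobius z t ((q - 2) * t + 1) ((q - 1) * t) := by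
  funext w
  unfold Rmap sqMobius
  ring

section SqMobius

variable {z t a b : ℝ}

theorem hasDerivAt_sqMobius {w : ℝ} (hw : 1 + b * w ≠ 0) :
    HasDerivAt (sqMobius z t a b)
      (2 * z * (t + a * w) * (a - b * t) / (1 + b * w) ^ 3) w := by
  have h1 : HasDerivAt (fun w : ℝ => t + a * w) a w := by
    simpa using ((hasDerivAt_id w).const_mul a).const_add t
  have h2 : HasDerivAt (fun w : ℝ => 1 + b * w) b w := by
    simpa using ((hasDerivAt_id w).const_mul b).const_add 1
  refine (((h1.div h2 hw).pow 2).const_mul z).congr_deriv ?_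
  simp only [Pi.div_apply, Nat.cast_ofNat, Nat.add_one_sub_one, pow_one]
  field_simp
  ring

theorem monotoneOn_sqMobius (hz : 0 < z) (ht : 0 < t) (ha : 0 < a) (hb : 0 < b)
    (hab : b * t < a) : MonotoneOn (sqMobius z t a b) (Ici 0) := by
  intro x hx y hy hxy
  have hx : 0 ≤ x := hx
  have hy : 0 ≤ y := hy
  unfold sqMobius
  gcongr z * ?_ ^ 2
  rw [div_le_div_iff₀ (by positivity) (by positivity)]
  nlinarith [mul_nonneg (sub_nonneg.2 hab.le) (sub_nonneg.2 hxy)]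

/-- If `w₀` is a double fixed point, the displacement factors through the third fixed point
`z t² / (b w₀)²`. -/
theorem sqMobius_sub_self {w₀ w : ℝ} (ht : 0 < t) (ha : 0 < a) (hb : 0 < b) (hw₀ : 0 < w₀)
    (hcrit : a * b * w₀ ^ 2 + (3 * b * t - a) * w₀ + t = 0)
    (hfix : z * (t + a * w₀) ^ 2 = w₀ * (1 + b * w₀) ^ 2) (hw : 0 ≤ w) :
    sqMobius z t a b w - w =
      b ^ 2 * (w - w₀) ^ 2 * (z * t ^ 2 / (b * w₀) ^ 2 - w) / (1 + b * w) ^ 2 := by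
  have hne : t + a * w₀ ≠ 0 := by positivity
  have hderiv : (1 + b * w₀) * (1 + 3 * b * w₀) = 2 * a * z * (t + a * w₀) := by
    apply mul_right_cancel₀ hne
    linear_combination (1 + b * w₀) * hcrit - 2 * a * hfix
  have hwne : 1 + b * w ≠ 0 := by positivity
  unfold sqMobius
  field_simp
  have hlin : 2 * z * a * t * w₀ = w₀ - b ^ 2 * w₀ ^ 3 - 2 * z * t ^ 2 := by
    linear_combination 2 * hfix + w₀ * hderiv
  linear_combination w ^ 2 * (hfix - hlin) + w * w₀ * hlin

/-- If `w₀` is a double fixed point and `z` lies on the same side of `w₀` as the third fixed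
point, then the orbit of `z` converges to the latter, which is attracting. -/
theorem exists_attracting_of_doubleFixed {w₀ : ℝ} (hz : 0 < z) (ht : 0 < t) (ha : 0 < a)
    (hb : 0 < b) (hab : b * t < a) (hw₀ : 0 < w₀)
    (hcrit : a * b * w₀ ^ 2 + (3 * b * t - a) * w₀ + t = 0)
    (hfix : z * (t + a * w₀) ^ 2 = w₀ * (1 + b * w₀) ^ 2)
    (hside : w₀ < z ∧ w₀ < z * t ^ 2 / (b * w₀) ^ 2 ∨
      z < w₀ ∧ z * t ^ 2 / (b * w₀) ^ 2 < w₀) :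
    ∃ wA : ℝ, sqMobius z t a b wA = wA ∧ 0 < deriv (sqMobius z t a b) wA ∧
      deriv (sqMobius z t a b) wA < 1 ∧
      Tendsto (fun n : ℕ => (sqMobius z t a b)^[n] z) atTop (𝓝 wA) := by
  have hsub := fun w (hw : 0 ≤ w) => sqMobius_sub_self ht ha hb hw₀ hcrit hfix hw
  set p := z * t ^ 2 / (b * w₀) ^ 2
  have hp : 0 < p := by positivity
  have hne : p ≠ w₀ := by rcases hside with h | h; exacts [h.2.ne', h.2.ne]
  have hderiv : ∀ w, 0 ≤ w → HasDerivAt (sqMobius z t a b)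
      (2 * z * (t + a * w) * (a - b * t) / (1 + b * w) ^ 3) w := fun w hw =>
    hasDerivAt_sqMobius (by positivity)
  have hpfix : sqMobius z t a b p = p := by
    have := hsub p hp.le
    rw [sub_self, mul_zero, zero_div] at this
    linarith
  have hcont : ContinuousOn (sqMobius z t a b) (Ici 0) := fun w hw =>
    (hderiv w hw).continuousAt.continuousWithinAt
  have hmono := monotoneOn_sqMobius hz ht ha hb hab
  refine ⟨p, hpfix, ?_, ?_, ?_⟩
  · rw [(hderiv p hp.le).deriv]
    have := sub_pos.2 hab
    positivity
  · have hd : HasDerivAt (fun w => sqMobius z t a b w - w)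
        (-(b ^ 2 * (p - w₀) ^ 2 / (1 + b * p) ^ 2)) p := by
      have h1 : ContinuousAt (fun w : ℝ => b ^ 2 * (w - w₀) ^ 2 / (1 + b * w) ^ 2) p :=
        ContinuousAt.div (by fun_prop) (by fun_prop) (by positivity)
      rw [hasDerivAt_iff_tendsto_slope]
      refine (h1.neg.tendsto.mono_left nhdsWithin_le_nhds).congr' ?_
      filter_upwards [self_mem_nhdsWithin, nhdsWithin_le_nhds (lt_mem_nhds hp)] with w hwp hw
      have hwp : w - p ≠ 0 := sub_ne_zero.2 hwp
      rw [slope_def_field, hsub w hw.le, hpfix, sub_self, Pi.neg_apply]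
      field_simp
      ring
    have hval := ((hderiv p hp.le).sub (hasDerivAt_id p)).unique hd
    have hpos : 0 < b ^ 2 * (p - w₀) ^ 2 / (1 + b * p) ^ 2 := by
      have := sub_ne_zero.2 hne
      positivity
    rw [(hderiv p hp.le).deriv]
    linarith
  · rcases le_total z p with hzp | hzp
    · have hIcc : Icc z p ⊆ Ici 0 := fun w hw => hz.le.trans hw.1
      refine tendsto_iterate_of_lt_map hzp (hmono.mono hIcc) (hcont.mono hIcc) hpfix ?_
      intro y hzy hyp
      have hy : 0 < y := hz.trans_le hzy
      have hyw : y - w₀ ≠ 0 := by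
        rcases hside with h | h
        · exact sub_ne_zero.2 (h.1.trans_le hzy).ne'
        · exact sub_ne_zero.2 (hyp.trans h.2).ne
      have hyp' := sub_pos.2 hyp
      rw [← sub_pos, hsub y hy.le]
      positivity
    · have hIcc : Icc p z ⊆ Ici 0 := fun w hw => hp.le.trans hw.1
      refine tendsto_iterate_of_map_lt hzp (hmono.mono hIcc) (hcont.mono hIcc) hpfix ?_
      intro y hyz hpy
      have hy : 0 < y := hp.trans hpy
      have hyw : y - w₀ ≠ 0 := by
        rcases hside with h | h
        · exact sub_ne_zero.2 (h.2.trans hpy).ne'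
        · exact sub_ne_zero.2 (hyz.trans_lt h.1).ne
      have hpy' := sub_pos.2 hpy
      rw [← sub_neg, hsub y hy.le, ← neg_pos, ← neg_div, ← mul_neg, neg_sub]
      positivity

/-- The two critical points of `w ↦ w (1 + b w)² / (t + a w)²` are the roots of
`a b w² + (3 b t - a) w + t`, one for each square root `s` of the discriminant; the
critical value is explicit in terms of `s`. -/
theorem doubleFixed_identities {s w₀ : ℝ} (ht : 0 < t) (ha : 0 < a) (hb : 0 < b)
    (hs : s ^ 2 = (a - b * t) * (a - 9 * (b * t)))
    (hw : w₀ = (a - 3 * (b * t) - s) / (2 * a * b))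
    (hz : z = (a ^ 2 + 18 * a * (b * t) - 27 * (b * t) ^ 2 + (a - 9 * (b * t)) * s)
      / (8 * t * a ^ 3)) :
    a * b * w₀ ^ 2 + (3 * b * t - a) * w₀ + t = 0 ∧
      z * (t + a * w₀) ^ 2 = w₀ * (1 + b * w₀) ^ 2 := by
  subst hw hz
  constructor
  · field_simp
    linear_combination hs
  · have h1 : 1 + b * ((a - 3 * (b * t) - s) / (2 * a * b)) =
        (3 * a - 3 * (b * t) - s) / (2 * a) := by
      field_simp
      ring
    have h2 : t + a * ((a - 3 * (b * t) - s) / (2 * a * b)) = (a - b * t - s) / (2 * b) := by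
      field_simp
      ring
    rw [h1, h2]
    field_simp
    linear_combination 2 * ((a - 5 * (b * t)) * s - (a - b * t) * (a - 9 * (b * t))) * hs

/-- The sides of the double fixed point `w₀` on which `z` and the third fixed point lie. -/
theorem lt_iff_of_doubleFixed {w₀ : ℝ} (ht : 0 < t) (ha : 0 < a) (hb : 0 < b) (hw₀ : 0 < w₀)
    (hba : b < a) (h1 : a - b = 1 - t)
    (hfix : z * (t + a * w₀) ^ 2 = w₀ * (1 + b * w₀) ^ 2) :
    (w₀ < z ↔ w₀ < 1) ∧ (z < w₀ ↔ 1 < w₀) ∧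
    (w₀ < z * t ^ 2 / (b * w₀) ^ 2 ↔ a * b * w₀ ^ 2 < t) ∧
    (z * t ^ 2 / (b * w₀) ^ 2 < w₀ ↔ t < a * b * w₀ ^ 2) := by
  have hzeq : z = w₀ * ((1 + b * w₀) / (t + a * w₀)) ^ 2 := by
    field_simp
    linear_combination hfix
  have hpeq : z * t ^ 2 / (b * w₀) ^ 2 =
      w₀ * (t * (1 + b * w₀) / (b * w₀ * (t + a * w₀))) ^ 2 := by
    rw [hzeq]
    field_simp
  have hpos : 0 < a - b := sub_pos.2 hba
  have hkey : (1 + b * w₀) - (t + a * w₀) = (a - b) * (1 - w₀) := by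
    linear_combination -h1
  refine ⟨?_, ?_, ?_, ?_⟩
  · rw [hzeq, lt_mul_iff_one_lt_right hw₀, one_lt_sq_iff₀ (by positivity),
      one_lt_div (by positivity), ← sub_pos, hkey, mul_pos_iff_of_pos_left hpos, sub_pos]
  · rw [hzeq, mul_lt_iff_lt_one_right hw₀, sq_lt_one_iff₀ (by positivity),
      div_lt_one (by positivity), ← sub_neg, hkey, mul_neg_iff, sub_neg]
    grind
  · rw [hpeq, lt_mul_iff_one_lt_right hw₀, one_lt_sq_iff₀ (by positivity),
      one_lt_div (by positivity)]
    constructor <;> intro h <;> linarith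
  · rw [hpeq, mul_lt_iff_lt_one_right hw₀, sq_lt_one_iff₀ (by positivity),
      div_lt_one (by positivity)]
    constructor <;> intro h <;> linarith

end SqMobius

section Potts

variable {Q t : ℝ}

theorem discriminant_pos_of_lt_tTwo (hQ : 2 ≤ Q) (ht : 0 < t) (h : t < tTwo Q) :
    0 < ((Q - 2) * t + 1) - 9 * ((Q - 1) * t * t) := by
  have hD : 0 ≤ Q ^ 2 + 32 * Q - 32 := by nlinarith
  have hQ1 : 0 < Q - 1 := by linarith
  rw [tTwo, lt_div_iff₀ (by positivity)] at h
  have hpos : 0 < t * (18 * (Q - 1)) := by positivity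
  have hle : Q - 2 ≤ √(Q ^ 2 + 32 * Q - 32) := Real.le_sqrt_of_sq_le (by nlinarith)
  have hsq := sq_lt_sq' (a := 18 * (Q - 1) * t - (Q - 2)) (b := √(Q ^ 2 + 32 * Q - 32))
    (by linarith) (by linarith)
  rw [Real.sq_sqrt hD] at hsq
  refine pos_of_mul_pos_right (a := 36 * (Q - 1)) ?_ (by positivity)
  linarith

theorem lt_one_of_discriminant_pos (hQ : 2 ≤ Q) (ht : 0 < t)
    (h : 0 < ((Q - 2) * t + 1) - 9 * ((Q - 1) * t * t)) : t < 1 := by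
  nlinarith [mul_nonneg (by linarith : 0 ≤ Q - 2) ht.le]

theorem discriminant_pos_of_lt_tOne (hQ : 2 ≤ Q) (ht : 0 < t) (h : t < tOne Q) :
    0 < ((Q - 2) * t + 1) - 9 * ((Q - 1) * t * t) := by
  rw [tOne, lt_div_iff₀ (by linarith)] at h
  have hQt : 0 ≤ (Q - 2) * t := mul_nonneg (by linarith) ht.le
  have ht1 : t < 1 := by nlinarith
  have hb : 0 < (Q - 1) * t := mul_pos (by linarith) ht
  have hneg : 0 < (1 - t * (1 + Q)) * ((Q - 1) * t + 1) * (((Q - 2) * t + 1) * ((Q - 1) * t)) :=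
    mul_pos (mul_pos (by linarith) (by linarith)) (mul_pos (by linarith) hb)
  refine pos_of_mul_pos_right (a := (1 - t) * (1 + (Q - 1) * t)) ?_
    (mul_nonneg (by linarith) (by linarith))
  linarith [sq_nonneg (2 * ((Q - 2) * t + 1) * ((Q - 1) * t) + 3 * ((Q - 1) * t * t) -
    ((Q - 2) * t + 1))]

theorem discriminant_mul_pos (hQ : 2 ≤ Q) (ht : 0 < t)
    (h : 0 < ((Q - 2) * t + 1) - 9 * ((Q - 1) * t * t)) :
    0 < (((Q - 2) * t + 1) - (Q - 1) * t * t) *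
      (((Q - 2) * t + 1) - 9 * ((Q - 1) * t * t)) := by
  have hb : 0 < (Q - 1) * t := mul_pos (by linarith) ht
  have hfac : ((Q - 2) * t + 1) - (Q - 1) * t * t = (1 - t) * (1 + (Q - 1) * t) := by ring
  have ht1 := lt_one_of_discriminant_pos hQ ht h
  rw [hfac]
  exact mul_pos (mul_pos (by linarith) (by linarith)) h

theorem sqrt_discriminant_cube (h : 0 < ((Q - 2) * t + 1) - 9 * ((Q - 1) * t * t)) :
    √((t - 1) * ((Q - 1) * t + 1) * (9 * (Q - 1) * t ^ 2 - (Q - 2) * t - 1) ^ 3) =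
      (((Q - 2) * t + 1) - 9 * ((Q - 1) * t * t)) *
        √((((Q - 2) * t + 1) - (Q - 1) * t * t) *
          (((Q - 2) * t + 1) - 9 * ((Q - 1) * t * t))) := by
  rw [show (t - 1) * ((Q - 1) * t + 1) * (9 * (Q - 1) * t ^ 2 - (Q - 2) * t - 1) ^ 3 =
      (((Q - 2) * t + 1) - 9 * ((Q - 1) * t * t)) ^ 2 *
        ((((Q - 2) * t + 1) - (Q - 1) * t * t) *
          (((Q - 2) * t + 1) - 9 * ((Q - 1) * t * t))) by ring,
    Real.sqrt_mul (sq_nonneg _), Real.sqrt_sq h.le]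

/-- Both halves of the main theorem: `s` is a square root of the discriminant, and `w₀` the
corresponding double fixed point. -/
theorem Rmap_exists_attracting {s z : ℝ} (hQ : 2 ≤ Q) (ht : 0 < t)
    (hpos : 0 < ((Q - 2) * t + 1) - 9 * ((Q - 1) * t * t))
    (hs : s ^ 2 = (((Q - 2) * t + 1) - (Q - 1) * t * t) *
      (((Q - 2) * t + 1) - 9 * ((Q - 1) * t * t)))
    (hz : z = (((Q - 2) * t + 1) ^ 2 + 18 * ((Q - 2) * t + 1) * ((Q - 1) * t * t)
        - 27 * ((Q - 1) * t * t) ^ 2 + (((Q - 2) * t + 1) - 9 * ((Q - 1) * t * t)) * s)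
      / (8 * t * ((Q - 2) * t + 1) ^ 3))
    (hside : 0 < s ∨ s < 0 ∧ t < tOne Q) :
    ∃ wA : ℝ, Rmap z t Q wA = wA ∧ 0 < deriv (Rmap z t Q) wA ∧ deriv (Rmap z t Q) wA < 1 ∧
      Tendsto (fun n : ℕ => (Rmap z t Q)^[n] z) atTop (𝓝 wA) := by
  rw [Rmap_eq_sqMobius]
  have ht1 := lt_one_of_discriminant_pos hQ ht hpos
  have hQ1 : 1 ≤ Q - 1 := by linarith
  have ha1 : 1 ≤ (Q - 2) * t + 1 := by
    linarith [mul_nonneg (by linarith : 0 ≤ Q - 2) ht.le]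
  have hb : 0 < (Q - 1) * t := by positivity
  have htb : t ≤ (Q - 1) * t := le_mul_of_one_le_left ht.le hQ1
  have h1 : ((Q - 2) * t + 1) - (Q - 1) * t = 1 - t := by ring
  have hP1 : t < tOne Q → ((Q - 2) * t + 1) * ((Q - 1) * t) +
      (3 * ((Q - 1) * t) * t - ((Q - 2) * t + 1)) + t < 0 := by
    intro h
    rw [tOne, lt_div_iff₀ (by linarith)] at h
    have hmul : 0 < (1 - t * (1 + Q)) * ((Q - 1) * t + 1) :=
      mul_pos (by linarith) (by positivity)
    linarith
  have hfac : ((Q - 2) * t + 1) - (Q - 1) * t * t = (1 - t) * (1 + (Q - 1) * t) := by ring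
  have hab : (Q - 1) * t * t < (Q - 2) * t + 1 := by
    rw [← sub_pos, hfac]
    exact mul_pos (by linarith) (by positivity)
  generalize (Q - 2) * t + 1 = a at *
  generalize (Q - 1) * t = b at *
  have ha : 0 < a := by linarith
  have hu : 0 < b * t := by positivity
  obtain ⟨w₀, hw⟩ : ∃ w₀, w₀ = (a - 3 * (b * t) - s) / (2 * a * b) := ⟨_, rfl⟩
  obtain ⟨hcrit, hfix⟩ := doubleFixed_identities ht ha hb hs hw hz
  have hs_lt : s < a - 3 * (b * t) := by
    refine lt_of_pow_lt_pow_left₀ 2 (by linarith) ?_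
    nlinarith [mul_pos ha hu]
  have hw₀ : 0 < w₀ := by
    rw [hw]
    exact div_pos (by linarith) (by positivity)
  have hs_eq : s = a - 3 * (b * t) - 2 * a * b * w₀ := by
    rw [hw]
    field_simp
    ring
  have hzpos : 0 < z := by
    refine pos_of_mul_pos_left (b := (t + a * w₀) ^ 2) ?_ (by positivity)
    rw [hfix]
    positivity
  obtain ⟨h₁, h₂, h₃, h₄⟩ :=
    lt_iff_of_doubleFixed ht ha hb hw₀ (by linarith) h1 hfix
  have hprod : a * b * w₀ ^ 2 - t = -(w₀ * s) := by
    rw [hs_eq]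
    linear_combination -hcrit
  refine exists_attracting_of_doubleFixed hzpos ht ha hb hab hw₀ hcrit hfix ?_
  rw [h₁, h₂, h₃, h₄]
  refine hside.imp (fun h => ?_) (fun h => ?_)
  · have hlt : a * b * w₀ ^ 2 < t := by linarith [mul_pos hw₀ h]
    refine ⟨?_, hlt⟩
    have hle : t ≤ a * b := htb.trans (le_mul_of_one_le_left hb.le ha1)
    have hsq : w₀ ^ 2 < 1 := by
      by_contra! hge
      linarith [mul_le_mul_of_nonneg_left hge (mul_pos ha hb).le]
    exact (sq_lt_one_iff₀ hw₀.le).1 hsq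
  · refine ⟨?_, by linarith [mul_neg_of_pos_of_neg hw₀ h.1]⟩
    by_contra! hle
    have hpos' : 0 ≤ (1 - w₀) * (a * b * (1 - w₀) - s) :=
      mul_nonneg (by linarith) (by
        linarith [mul_nonneg (mul_pos ha hb).le (sub_nonneg.2 hle), h.1])
    rw [hs_eq] at hpos'
    linarith [hP1 h.2]

end Potts

/-- **Lemma (orbit convergence to an attracting fixed point at `z = N_±(t,q)`).**
Let `q ≥ 2` be a natural number.
(i) If `t ∈ (0, t₂(q))` and `z = N₊(t,q)`, then the orbit of the marked point `z` under
`R_{z,t,q}` converges to an attracting fixed point `w_A` (`0 < R'_{z,t,q}(w_A) < 1`).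
(ii) If `t ∈ (0, t₁(q))` and `z = N₋(t,q)`, then likewise the orbit of `z` under
`R_{z,t,q}` converges to an attracting fixed point `w_A`. -/
theorem orbit_converges_to_attracting_at_Npm (q : ℕ) (hq : 2 ≤ q) :
    (∀ t : ℝ, 0 < t → t < tTwo q →
      ∃ wA : ℝ, Rmap (Nplus q t) t q wA = wA ∧
        0 < deriv (Rmap (Nplus q t) t q) wA ∧ deriv (Rmap (Nplus q t) t q) wA < 1 ∧
        Filter.Tendsto (fun n : ℕ => (Rmap (Nplus q t) t q)^[n] (Nplus q t))
          Filter.atTop (nhds wA)) ∧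
    (∀ t : ℝ, 0 < t → t < tOne q →
      ∃ wA : ℝ, Rmap (Nminus q t) t q wA = wA ∧
        0 < deriv (Rmap (Nminus q t) t q) wA ∧ deriv (Rmap (Nminus q t) t q) wA < 1 ∧
        Filter.Tendsto (fun n : ℕ => (Rmap (Nminus q t) t q)^[n] (Nminus q t))
          Filter.atTop (nhds wA)) := by
  have hQ : (2 : ℝ) ≤ q := by exact_mod_cast hq
  refine ⟨fun t ht h => ?_, fun t ht h => ?_⟩
  · have hpos := discriminant_pos_of_lt_tTwo hQ ht h
    have hdisc := discriminant_mul_pos hQ ht hpos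
    refine Rmap_exists_attracting hQ ht hpos (Real.sq_sqrt hdisc.le) ?_
      (Or.inl (Real.sqrt_pos.2 hdisc))
    rw [Nplus, sqrt_discriminant_cube hpos]
    ring
  · have hpos := discriminant_pos_of_lt_tOne hQ ht h
    have hdisc := discriminant_mul_pos hQ ht hpos
    refine Rmap_exists_attracting hQ ht hpos ((neg_sq _).trans (Real.sq_sqrt hdisc.le)) ?_
      (Or.inr ⟨neg_neg_of_pos (Real.sqrt_pos.2 hdisc), h⟩)
    rw [Nminus, sqrt_discriminant_cube hpos]
    ring
end
end
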